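/- arXiv:math/0310420 — 2 statements merged into one kernel-verified Lean document; each statement's English description precedes it below -/
import Mathlib

section
/- The forest complex of any finite graph G with vertex set V and c connected components is (|V| − c − 2)-connected. -/
open scoped BigOperators
noncomputable section

/-- A face of the forest complex of `G`: a nonempty circle-free set of edges of `G`. -/
def ForestFace {V : Type*} (G : SimpleGraph V) (σ : Finset (Sym2 V)) : Prop :=
  σ.Nonempty ∧ (σ : Set (Sym2 V)) ⊆ G.edgeSet ∧
    (SimpleGraph.fromEdgeSet (σ : Set (Sym2 V))).IsAcyclic

/-- The geometric realization of the simplicial complex with face predicate `P`. -/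
abbrev SReal {α : Type*} [Fintype α] (P : Finset α → Prop) : Type _ :=
  {f : α → ℝ // (∀ a, 0 ≤ f a) ∧ (∑ a, f a) = 1 ∧ ∃ σ : Finset α, P σ ∧ ∀ a, f a ≠ 0 → a ∈ σ}

/-- `X` is `n`-connected: nonempty when `n ≥ -1`, and all homotopy groups `π_i`
vanish for `0 ≤ i ≤ n`.  (`(-1)`-connected just means nonempty.) -/
def IsConn (n : ℤ) (X : Type*) [TopologicalSpace X] : Prop :=
  (-1 ≤ n → Nonempty X) ∧
    ∀ i : ℕ, (i : ℤ) ≤ n → ∀ x : X, Subsingleton (HomotopyGroup (Fin i) X x)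


/-- Complexes obtained by a shelling with facets of cardinality `d`. -/
inductive Shell {α : Type*} (d : ℕ) : (Finset α → Prop) → Prop
  | void : Shell d (fun _ => False)
  | step (Δ : Finset α → Prop) (F R : Finset α) : Shell d Δ → F.card = d → R ⊆ F →
      (∀ σ, σ ⊆ F → (Δ σ ↔ ¬ R ⊆ σ)) → Shell d (fun σ => Δ σ ∨ σ ⊆ F)

theorem Shell.hered {α : Type*} {d : ℕ} {Δ : Finset α → Prop} (h : Shell d Δ) :
    ∀ σ τ, Δ σ → τ ⊆ σ → Δ τ := by
  induction h with
  | void => exact fun _ _ h _ => h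
  | step Δ F R hs hF hR hd ih =>
    rintro σ τ (h | h) hτ
    · exact Or.inl (ih _ _ h hτ)
    · exact Or.inr (hτ.trans h)

theorem Shell.join {α : Type*} [DecidableEq α] {d : ℕ} {D L : Finset α → Prop} (e : α)
    (hD : Shell (d+1) D) (hL : Shell d L) (hDe : ∀ σ, D σ → e ∉ σ)
    (hLe : ∀ σ, L σ → e ∉ σ ∧ D σ) :
    Shell (d+1) (fun σ => D σ ∨ (e ∈ σ ∧ L (σ.erase e))) := by
  induction hL with
  | void => simpa using hD
  | step Δ F R hs hF hR hd ih =>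
    have ih' := ih (fun σ h => hLe σ (Or.inl h))
    have heF : e ∉ F := (hLe F (Or.inr subset_rfl)).1
    have := Shell.step _ (insert e F) (insert e R) ih' (by simp [heF, hF])
      (Finset.insert_subset_insert _ hR) (by
        intro σ hσ
        have h1 : σ.erase e ⊆ F := by
          intro x hx; have := hσ (Finset.mem_of_mem_erase hx)
          rcases Finset.mem_insert.1 this with h | h
          · exact absurd h (Finset.ne_of_mem_erase hx)
          · exact h
        have h2 := hd _ h1
        have heR : e ∉ R := fun h => heF (hR h)
        by_cases he : e ∈ σ
        · have : ¬ D σ := fun h => hDe _ h he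
          rw [h2]
          simp only [this, he, Finset.insert_subset_iff, Finset.subset_erase, heR]
          tauto
        · have : D σ := (hLe σ (Or.inr (by rwa [Finset.erase_eq_of_notMem he] at h1))).2
          simp [this, he, Finset.insert_subset_iff])
    convert this using 2 with σ
    by_cases he : e ∈ σ
    · have : σ.erase e ⊆ F ↔ σ ⊆ insert e F := by
        rw [Finset.subset_insert_iff]
      simp only [he, this]; tauto
    · simp only [he, false_and, or_false]
      constructor
      · exact Or.inl
      · rintro (h | h)
        · exact h
        · exact (hLe σ (Or.inr (by rwa [Finset.subset_insert_iff_of_notMem he] at h))).2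

theorem Shell.cone {α : Type*} [DecidableEq α] {d : ℕ} {L : Finset α → Prop} (e : α)
    (hL : Shell d L) (hLe : ∀ σ, L σ → e ∉ σ) :
    Shell (d+1) (fun σ => L (σ.erase e)) := by
  induction hL with
  | void => exact Shell.void
  | step Δ F R hs hF hR hd ih =>
    have ih' := ih (fun σ h => hLe σ (Or.inl h))
    have heF : e ∉ F := (hLe F (Or.inr subset_rfl))
    have := Shell.step _ (insert e F) R ih' (by simp [heF, hF])
      (hR.trans (Finset.subset_insert _ _)) (by
        intro σ hσ
        have h1 : σ.erase e ⊆ F := by rwa [Finset.subset_insert_iff] at hσ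
        have heR : e ∉ R := fun h => heF (hR h)
        rw [hd _ h1, Finset.subset_erase]; tauto)
    simpa only [Finset.subset_insert_iff] using this

/-- Independence systems of matroids of rank `d` are shellable. -/
theorem shell_of_matroid {α : Type*} [DecidableEq α] (S : Finset α) :
    ∀ (d : ℕ) (I : Finset α → Prop), (∀ σ, I σ → σ ⊆ S) → (∀ σ τ, I σ → τ ⊆ σ → I τ) →
    (∀ σ τ, I σ → I τ → σ.card < τ.card → ∃ e ∈ τ, e ∉ σ ∧ I (insert e σ)) →
    (∃ σ, I σ ∧ σ.card = d) → (∀ σ, I σ → σ.card ≤ d) → Shell d I := by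
  induction S using Finset.induction_on with
  | empty =>
    intro d I hS hh ha ⟨σ, hσ, hc⟩ hm
    have h0 : σ = ∅ := Finset.subset_empty.1 (hS σ hσ)
    subst h0
    have : I = fun σ => False ∨ σ ⊆ ∅ := by
      funext τ; apply propext
      constructor
      · exact fun h => Or.inr (hS _ h)
      · rintro (h | h)
        · exact h.elim
        · rw [Finset.subset_empty.1 h]; exact hσ
    rw [this]
    exact Shell.step _ ∅ ∅ Shell.void hc subset_rfl (by simp)
  | insert e S he ih =>
    intro d I hS hh ha hex hm
    by_cases hIe : I {e}
    swap
    · refine ih d I (fun σ h => ?_) hh ha hex hm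
      have : e ∉ σ := fun h' => hIe (hh _ _ h (by simpa using h'))
      have := hS σ h
      rwa [Finset.subset_insert_iff_of_notMem ‹_›] at this
    obtain ⟨B, hB, hBc⟩ := hex
    -- extend any independent set to one of size d
    have hext : ∀ k σ, I σ → σ.card + k = d → ∃ τ, I τ ∧ σ ⊆ τ ∧ τ.card = d := by
      intro k
      induction k with
      | zero => exact fun σ h1 h2 => ⟨σ, h1, subset_rfl, h2⟩
      | succ k ihk =>
        intro σ h1 h2
        obtain ⟨x, hx, hxσ, hxI⟩ := ha σ B h1 hB (by omega)
        obtain ⟨τ, h3, h4, h5⟩ := ihk (insert x σ) hxI (by rw [Finset.card_insert_of_notMem hxσ]; omega)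
        exact ⟨τ, h3, (Finset.subset_insert _ _).trans h4, h5⟩
    have hext' : ∀ σ, I σ → ∃ τ, I τ ∧ σ ⊆ τ ∧ τ.card = d := fun σ h =>
      hext (d - σ.card) σ h (by have := hm σ h; omega)
    obtain ⟨Be, hBe, heBe, hBec⟩ := hext' _ hIe
    have heBe : e ∈ Be := by simpa using heBe
    obtain ⟨d, rfl⟩ : ∃ d', d = d' + 1 := ⟨d - 1, by
      have := Finset.card_pos.2 ⟨e, heBe⟩; omega⟩
    let L : Finset α → Prop := fun σ => e ∉ σ ∧ I (insert e σ)
    have hL : Shell d L := by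
      refine ih d L ?_ ?_ ?_ ?_ ?_
      · rintro σ ⟨h1, h2⟩
        have := (Finset.subset_insert e σ).trans (hS _ h2)
        rwa [Finset.subset_insert_iff_of_notMem h1] at this
      · rintro σ τ ⟨h1, h2⟩ h3
        exact ⟨fun h => h1 (h3 h), hh _ _ h2 (Finset.insert_subset_insert _ h3)⟩
      · rintro σ τ ⟨h1, h2⟩ ⟨h3, h4⟩ hc
        obtain ⟨x, hx, hxσ, hxI⟩ := ha _ _ h2 h4 (by simpa [h1, h3] using hc)
        rw [Finset.mem_insert] at hx hxσ
        push Not at hxσ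
        refine ⟨x, hx.resolve_left hxσ.1, hxσ.2, ?_, ?_⟩
        · simp [h1, Ne.symm hxσ.1]
        · rwa [Finset.insert_comm]
      · exact ⟨Be.erase e, ⟨by simp, by rwa [Finset.insert_erase heBe]⟩, by
          rw [Finset.card_erase_of_mem heBe]; omega⟩
      · rintro σ ⟨h1, h2⟩
        have := hm _ h2
        rw [Finset.card_insert_of_notMem h1] at this; omega
    by_cases hD : ∃ σ, (I σ ∧ e ∉ σ) ∧ σ.card = d + 1
    · have hDs : Shell (d+1) (fun σ => I σ ∧ e ∉ σ) := by
        refine ih (d+1) _ ?_ ?_ ?_ hD ?_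
        · rintro σ ⟨h1, h2⟩
          have := hS _ h1
          rwa [Finset.subset_insert_iff_of_notMem h2] at this
        · rintro σ τ ⟨h1, h2⟩ h3
          exact ⟨hh _ _ h1 h3, fun h => h2 (h3 h)⟩
        · rintro σ τ ⟨h1, h2⟩ ⟨h3, h4⟩ hc
          obtain ⟨x, hx, hxσ, hxI⟩ := ha _ _ h1 h3 hc
          refine ⟨x, hx, hxσ, hxI, ?_⟩
          rw [Finset.mem_insert]; rintro (rfl | h)
          · exact h4 hx
          · exact h2 h
        · exact fun σ h => hm σ h.1
      have := Shell.join e hDs hL (fun σ h => h.2) (fun σ h =>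
        ⟨h.1, hh _ _ h.2 (Finset.subset_insert _ _), h.1⟩)
      convert this using 2 with σ
      by_cases h : e ∈ σ
      · simp [h, L]
      · simp [h]
    · have := Shell.cone e hL (fun σ h => h.1)
      convert this using 2 with σ
      constructor
      · intro h
        refine ⟨by simp, ?_⟩
        obtain ⟨τ, h1, h2, h3⟩ := hext' σ h
        have : e ∈ τ := by
          by_contra hc; exact hD ⟨τ, ⟨h1, hc⟩, h3⟩
        refine hh _ _ h1 ?_
        intro x hx
        rcases Finset.mem_insert.1 hx with rfl | hx
        · exact this
        · exact h2 (Finset.mem_of_mem_erase hx)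
      · intro h
        refine hh _ _ h.2 ?_
        intro x hx
        by_cases hxe : x = e <;> simp [hxe, hx]

section graph
open SimpleGraph

theorem reach_sup_edge {V : Type*} (H : SimpleGraph V) (u v : V) {w w' : V}
    (h : (H ⊔ edge u v).Reachable w w') :
    H.Reachable w w' ∨ (H.Reachable w u ∧ H.Reachable v w') ∨
      (H.Reachable w v ∧ H.Reachable u w') := by
  obtain ⟨p⟩ := h
  induction p with
  | nil => exact Or.inl (Reachable.refl _)
  | cons hadj p ih =>
    rw [sup_adj, edge_adj] at hadj
    rcases hadj with hadj | ⟨⟨rfl, rfl⟩ | ⟨rfl, rfl⟩, _⟩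
    · have h1 := hadj.reachable
      rcases ih with h | ⟨h, h'⟩ | ⟨h, h'⟩
      · exact Or.inl (h1.trans h)
      · exact Or.inr (Or.inl ⟨h1.trans h, h'⟩)
      · exact Or.inr (Or.inr ⟨h1.trans h, h'⟩)
    · rcases ih with h | ⟨h, h'⟩ | ⟨h, h'⟩
      · exact Or.inr (Or.inl ⟨Reachable.refl _, h⟩)
      · exact Or.inr (Or.inl ⟨Reachable.refl _, h'⟩)
      · exact Or.inl h'
    · rcases ih with h | ⟨h, h'⟩ | ⟨h, h'⟩
      · exact Or.inr (Or.inr ⟨Reachable.refl _, h⟩)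
      · exact Or.inl h'
      · exact Or.inr (Or.inr ⟨Reachable.refl _, h'⟩)

theorem card_cc_sup_edge {V : Type*} [Finite V] (H : SimpleGraph V) (u v : V)
    (h : ¬ H.Reachable u v) :
    Nat.card (H ⊔ edge u v).ConnectedComponent + 1 = Nat.card H.ConnectedComponent := by
  classical
  have huv : u ≠ v := fun h' => h (h' ▸ Reachable.refl _)
  have hadj : (H ⊔ edge u v).Adj u v := by simp [edge_adj, huv]
  let φ : {c : H.ConnectedComponent // c ≠ H.connectedComponentMk v} →
      (H ⊔ edge u v).ConnectedComponent := fun c => c.1.map (Hom.ofLE le_sup_left)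
  have hφ : Function.Bijective φ := by
    constructor
    · rintro ⟨c, hc⟩ ⟨c', hc'⟩ heq
      induction c using ConnectedComponent.ind with | _ w =>
      induction c' using ConnectedComponent.ind with | _ w' =>
      have : (H ⊔ edge u v).Reachable w w' := ConnectedComponent.exact heq
      apply Subtype.ext
      apply ConnectedComponent.sound
      rcases reach_sup_edge H u v this with h1 | ⟨h1, h2⟩ | ⟨h1, h2⟩
      · exact h1
      · exact absurd (ConnectedComponent.sound h2.symm) hc'
      · exact absurd (ConnectedComponent.sound h1) hc
    · intro c
      induction c using ConnectedComponent.ind with | _ w =>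
      by_cases hw : H.connectedComponentMk w = H.connectedComponentMk v
      · refine ⟨⟨H.connectedComponentMk u, fun h' => h (ConnectedComponent.exact h')⟩, ?_⟩
        apply ConnectedComponent.sound
        exact hadj.reachable.trans ((ConnectedComponent.exact hw).symm.mono le_sup_left)
      · exact ⟨⟨H.connectedComponentMk w, hw⟩, rfl⟩
  rw [← Nat.card_congr (Equiv.ofBijective φ hφ)]
  have := Fintype.ofFinite H.ConnectedComponent
  rw [Nat.card_eq_fintype_card, Nat.card_eq_fintype_card]
  have h2 := Fintype.card_subtype_compl (fun c => c = H.connectedComponentMk v)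
  have h3 : 0 < Fintype.card H.ConnectedComponent := Fintype.card_pos_iff.2 ⟨H.connectedComponentMk v⟩
  rw [Fintype.card_subtype_eq] at h2
  simp only [ne_eq]
  omega

theorem fromEdgeSet_insert' {V : Type*} (s : Set (Sym2 V)) (u v : V) :
    fromEdgeSet (insert s(u,v) s) = fromEdgeSet s ⊔ edge u v := by
  rw [edge, Set.insert_eq, Set.union_comm, fromEdgeSet_union]

/-- Independent edge sets. -/
def IndepF {V : Type*} (G : SimpleGraph V) (σ : Finset (Sym2 V)) : Prop :=
  (σ : Set (Sym2 V)) ⊆ G.edgeSet ∧ (fromEdgeSet (σ : Set (Sym2 V))).IsAcyclic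

theorem forest_count {V : Type*} [Fintype V] [DecidableEq V] (G : SimpleGraph V)
    (σ : Finset (Sym2 V)) : IndepF G σ →
    σ.card + Nat.card (fromEdgeSet (σ : Set (Sym2 V))).ConnectedComponent = Fintype.card V := by
  induction σ using Finset.induction_on with
  | empty =>
    intro _
    simp only [Finset.card_empty, Finset.coe_empty, fromEdgeSet_empty, zero_add]
    rw [← Nat.card_eq_fintype_card]
    refine (Nat.card_congr (Equiv.ofBijective (fun v => (⊥ : SimpleGraph V).connectedComponentMk v) ⟨?_, ?_⟩)).symm
    · intro a b h
      simpa using ConnectedComponent.exact h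
    · intro c
      induction c using ConnectedComponent.ind with | _ w => exact ⟨w, rfl⟩
  | insert e σ he ih =>
    induction e with | _ u v =>
    rintro ⟨h1, h2⟩
    rw [Finset.coe_insert, fromEdgeSet_insert', isAcyclic_sup_fromEdgeSet_iff] at h2
    have huv : G.Adj u v :=
      (mem_edgeSet G).1 (h1 (Finset.mem_coe.2 (Finset.mem_insert_self _ _)))
    have hn : ¬ (fromEdgeSet (σ : Set (Sym2 V))).Reachable u v := by
      intro h
      rcases h2.2 h with h | h
      · exact huv.ne h
      · rw [fromEdgeSet_adj] at h; exact he h.1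
    have := ih ⟨(by intro x hx; exact h1 (by simp at hx ⊢; exact Or.inr hx)), h2.1⟩
    rw [Finset.coe_insert, fromEdgeSet_insert', Finset.card_insert_of_notMem he]
    have h4 := card_cc_sup_edge _ u v hn
    omega

theorem forest_shell {V : Type*} [Fintype V] [DecidableEq V] (G : SimpleGraph V) :
    ∃ d : ℕ, d + Nat.card G.ConnectedComponent = Fintype.card V ∧ Shell d (IndepF G) ∧
      ∃ σ, IndepF G σ ∧ σ.card = d := by
  classical
  obtain ⟨F, hF, hFa, hFr⟩ := G.exists_isAcyclic_reachable_eq_le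
  have hbase : IndepF G F.edgeFinset := by
    refine ⟨?_, ?_⟩
    · simpa using hF
    · simpa using hFa
  have hcF : F.edgeFinset.card + Nat.card G.ConnectedComponent = Fintype.card V := by
    have h := forest_count G _ hbase
    rw [coe_edgeFinset, fromEdgeSet_edgeSet] at h
    rw [← h]
    congr 1
    exact Nat.card_congr (Quot.congr (Equiv.refl V) (fun a b => by rw [hFr]; rfl))
  refine ⟨F.edgeFinset.card, hcF, ?_, _, hbase, rfl⟩
  refine shell_of_matroid Finset.univ _ _ (fun _ _ => Finset.subset_univ _) ?_ ?_ ⟨_, hbase, rfl⟩ ?_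
  · rintro σ τ ⟨h1, h2⟩ h3
    have h3' : (τ : Set (Sym2 V)) ⊆ σ := by exact_mod_cast h3
    exact ⟨h3'.trans h1, h2.anti (fromEdgeSet_mono h3')⟩
  · intro σ τ hσ hτ hc
    by_contra hcon
    push Not at hcon
    have hr : ∀ a b, (fromEdgeSet (τ : Set (Sym2 V))).Adj a b →
        (fromEdgeSet (σ : Set (Sym2 V))).Reachable a b := by
      intro a b hab
      rw [fromEdgeSet_adj] at hab
      by_cases hs : s(a,b) ∈ σ
      · exact Adj.reachable (by rw [fromEdgeSet_adj]; exact ⟨hs, hab.2⟩)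
      · by_contra hn
        refine hcon _ hab.1 hs ⟨?_, ?_⟩
        · rw [Finset.coe_insert]
          exact Set.insert_subset (hτ.1 hab.1) hσ.1
        · rw [Finset.coe_insert, fromEdgeSet_insert']
          exact hσ.2.sup_edge_of_not_reachable hn
    have hr' : ∀ a b, (fromEdgeSet (τ : Set (Sym2 V))).Reachable a b →
        (fromEdgeSet (σ : Set (Sym2 V))).Reachable a b := by
      rintro a b ⟨p⟩
      induction p with
      | nil => exact Reachable.refl _
      | cons h p ih => exact (hr _ _ h).trans ih
    have h1 := forest_count G σ hσ
    have h2 := forest_count G τ hτ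
    have h3 : Nat.card (fromEdgeSet (σ : Set (Sym2 V))).ConnectedComponent ≤
        Nat.card (fromEdgeSet (τ : Set (Sym2 V))).ConnectedComponent := by
      refine Nat.card_le_card_of_surjective
        (Quot.map id (fun a b h => hr' a b h)) ?_
      intro c
      induction c using ConnectedComponent.ind with | _ w => exact ⟨connectedComponentMk _ w, rfl⟩
    omega
  · intro σ hσ
    have h1 := forest_count G σ hσ
    have h3 : Nat.card G.ConnectedComponent ≤
        Nat.card (fromEdgeSet (σ : Set (Sym2 V))).ConnectedComponent :=
      ConnectedComponent.card_le_card_of_le (by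
        intro a b h; rw [fromEdgeSet_adj] at h; exact hσ.1 h.1)
    omega
end graph
theorem sreal_cont {α : Type*} [Fintype α] {K : Type*} [TopologicalSpace K]
    {Δ : Finset α → Prop} (f : C(K, SReal Δ)) (a : α) : Continuous (fun k => (f k).1 a) :=
  (continuous_apply a).comp (continuous_subtype_val.comp f.continuous)

theorem sreal_homotopic {α : Type*} [Fintype α] {K : Type*} [TopologicalSpace K]
    {Δ : Finset α → Prop} (f g : C(K, SReal Δ))
    (h : ∀ k, ∃ σ, Δ σ ∧ (∀ a, (f k).1 a ≠ 0 → a ∈ σ) ∧ (∀ a, (g k).1 a ≠ 0 → a ∈ σ)) :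
    f.Homotopic g := by
  refine ⟨⟨⟨fun q => ⟨fun a => (1 - (q.1 : ℝ)) * (f q.2).1 a + (q.1 : ℝ) * (g q.2).1 a,
    ?_, ?_, ?_⟩, ?_⟩, ?_, ?_⟩⟩
  · intro a
    have h1 := q.1.2.1
    have h2 := q.1.2.2
    have h3 := (f q.2).2.1 a
    have h4 := (g q.2).2.1 a
    have : 0 ≤ 1 - (q.1 : ℝ) := by linarith
    positivity
  · rw [Finset.sum_add_distrib, ← Finset.mul_sum, ← Finset.mul_sum, (f q.2).2.2.1, (g q.2).2.2.1]
    ring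
  · obtain ⟨σ, h1, h2, h3⟩ := h q.2
    refine ⟨σ, h1, fun a ha => ?_⟩
    by_contra hc
    have h4 : (f q.2).1 a = 0 := by by_contra h'; exact hc (h2 a h')
    have h5 : (g q.2).1 a = 0 := by by_contra h'; exact hc (h3 a h')
    exact ha (by simp [h4, h5])
  · apply Continuous.subtype_mk
    apply continuous_pi
    intro a
    have h1 := (sreal_cont f a).comp (continuous_snd (X := unitInterval))
    have h2 := (sreal_cont g a).comp (continuous_snd (X := unitInterval))
    have h3 := continuous_subtype_val.comp (continuous_fst (X := unitInterval) (Y := K))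
    exact ((continuous_const.sub h3).mul h1).add (h3.mul h2)
  · intro k; apply Subtype.ext; funext a; simp
  · intro k; apply Subtype.ext; funext a; simp

/-- inclusion of realizations -/
def srealIncl {α : Type*} [Fintype α] {Δ Δ' : Finset α → Prop} (h : ∀ σ, Δ σ → Δ' σ) :
    C(SReal Δ, SReal Δ') where
  toFun y := ⟨y.1, y.2.1, y.2.2.1, by
    obtain ⟨σ, h1, h2⟩ := y.2.2.2
    exact ⟨σ, h _ h1, h2⟩⟩
  continuous_toFun := by fun_prop

theorem sreal_push {α : Type*} [Fintype α] [DecidableEq α] {K : Type*} [TopologicalSpace K]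
    {Δ : Finset α → Prop} (F R : Finset α) (hher : ∀ σ τ, Δ σ → τ ⊆ σ → Δ τ) (hR : R ⊆ F)
    (hne : R.Nonempty)
    (hd : ∀ σ, σ ⊆ F → (Δ σ ↔ ¬ R ⊆ σ)) (f : C(K, SReal (fun σ => Δ σ ∨ σ ⊆ F)))
    (p : α → ℝ) (p0 : ∀ a, a ∉ F → p a = 0) (pR : ∀ a ∈ R, 0 < p a)
    (pF : ∀ a, a ∉ R → p a ≤ 0)
    (ht : ∀ k, R.inf' hne (fun a => (f k).1 a / p a) * ∑ a, p a < 1) :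
    ∃ g : C(K, SReal Δ), f.Homotopic ((srealIncl (fun _ h => Or.inl h)).comp g) := by
  have hRΔ : ∀ σ, Δ σ → ¬ R ⊆ σ := fun σ hσ hRσ => (hd R hR).1 (hher _ _ hσ hRσ) subset_rfl
  set t : K → ℝ := fun k => R.inf' hne (fun a => (f k).1 a / p a) with htdef
  have tc : Continuous t := by
    apply Continuous.finset_inf'_apply
    intro a ha
    exact Continuous.div_const (sreal_cont f a) _
  have tle : ∀ k, ∀ a ∈ R, t k * p a ≤ (f k).1 a := by
    intro k a ha
    have : t k ≤ (f k).1 a / p a := Finset.inf'_le _ ha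
    rwa [le_div_iff₀ (pR a ha)] at this
  have t0 : ∀ k, 0 ≤ t k := by
    intro k
    apply Finset.le_inf'
    intro a ha
    exact div_nonneg ((f k).2.1 a) (pR a ha).le
  have tmin : ∀ k, ∃ a ∈ R, t k * p a = (f k).1 a := by
    intro k
    obtain ⟨a, ha, h⟩ := Finset.exists_mem_eq_inf' hne (fun a => (f k).1 a / p a)
    refine ⟨a, ha, ?_⟩
    rw [htdef]; simp only []; rw [h]
    have := (pR a ha).ne'
    field_simp
  have den : ∀ k, 0 < 1 - t k * ∑ a, p a := fun k => by have := ht k; linarith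
  -- case analysis
  have hcase : ∀ k, (t k = 0 ∧ ∃ σ, Δ σ ∧ ∀ a, (f k).1 a ≠ 0 → a ∈ σ) ∨
      (∀ a, (f k).1 a ≠ 0 → a ∈ F) := by
    intro k
    obtain ⟨σ, h1 | h1, h2⟩ := (f k).2.2.2
    · left
      refine ⟨?_, σ, h1, h2⟩
      have := hRΔ σ h1
      rw [Finset.not_subset] at this
      obtain ⟨a, ha, haσ⟩ := this
      have h3 : (f k).1 a = 0 := by by_contra h; exact haσ (h2 a h)
      have h4 := tle k a ha
      rw [h3] at h4
      have h5 := pR a ha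
      have h6 := t0 k
      nlinarith
    · exact Or.inr (fun a h => h1 (h2 a h))
  let g0 : K → α → ℝ := fun k a => ((f k).1 a - t k * p a) / (1 - t k * ∑ a, p a)
  have hg0 : ∀ k, t k = 0 → g0 k = (f k).1 := by
    intro k h; funext a; simp [g0, h]
  have hgF : ∀ k, (∀ a, (f k).1 a ≠ 0 → a ∈ F) → ∀ a, g0 k a ≠ 0 → a ∈ F := by
    intro k hk a ha
    by_contra hc
    have h1 : (f k).1 a = 0 := by by_contra h; exact hc (hk a h)
    exact ha (by simp [g0, h1, p0 a hc])
  refine ⟨⟨fun k => ⟨g0 k, ?_, ?_, ?_⟩, ?_⟩, ?_⟩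
  · intro a
    apply div_nonneg _ (den k).le
    by_cases ha : a ∈ R
    · have := tle k a ha; linarith
    · have h1 := pF a ha
      have h2 := t0 k
      have h3 := (f k).2.1 a
      nlinarith
  · simp only [g0]
    rw [← Finset.sum_div, Finset.sum_sub_distrib, ← Finset.mul_sum, (f k).2.2.1]
    exact div_self (den k).ne'
  · rcases hcase k with ⟨h1, σ, h2, h3⟩ | h1
    · refine ⟨σ, h2, ?_⟩
      rw [hg0 k h1]; exact h3
    · obtain ⟨b, hb, hbe⟩ := tmin k
      refine ⟨F.erase b, ?_, ?_⟩
      · rw [hd _ (Finset.erase_subset _ _)]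
        intro h; exact absurd (h hb) (by simp)
      · intro a ha
        refine Finset.mem_erase.2 ⟨?_, hgF k h1 a ha⟩
        rintro rfl
        exact ha (by simp [g0, hbe])
  · apply Continuous.subtype_mk
    apply continuous_pi
    intro a
    refine Continuous.div ((sreal_cont f a).sub (tc.mul continuous_const)) (by fun_prop) (fun k => (den k).ne')
  · apply sreal_homotopic
    intro k
    rcases hcase k with ⟨h1, σ, h2, h3⟩ | h1
    · refine ⟨σ, Or.inl h2, h3, ?_⟩
      change ∀ a, g0 k a ≠ 0 → a ∈ σ
      rw [hg0 k h1]; exact h3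
    · exact ⟨F, Or.inr subset_rfl, h1, hgF k h1⟩

/-- The sup-norm sphere. -/
abbrev Sph (n : ℕ) : Set (Fin (n+1) → ℝ) := Metric.sphere (0 : Fin (n+1) → ℝ) 1

theorem sph_coord {n : ℕ} {x : Fin (n+1) → ℝ} (hx : x ∈ Sph n) : ∃ i, |x i| = 1 := by
  rw [mem_sphere_zero_iff_norm] at hx
  by_contra hc
  push Not at hc
  have : ∀ i, ‖x i‖ < 1 := fun i => lt_of_le_of_ne (hx ▸ norm_le_pi_norm x i) (hc i)
  rw [← pi_norm_lt_iff one_pos] at this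
  linarith

theorem dimH_sph (n : ℕ) : dimH (Sph n) ≤ n := by
  have hsub : Sph n ⊆ ⋃ q : Fin (n+1) × Bool, Set.range
      (fun y : Fin n → ℝ => (Fin.insertNth q.1 (if q.2 then (1:ℝ) else -1) y : Fin (n+1) → ℝ)) := by
    intro x hx
    obtain ⟨i, hi⟩ := sph_coord hx
    rw [Set.mem_iUnion]
    rcases (abs_eq one_pos.le).1 hi with h | h
    · refine ⟨(i, true), fun j => x (i.succAbove j), ?_⟩
      simp only [if_true]
      rw [← h]; exact Fin.insertNth_self_removeNth i x
    · refine ⟨(i, false), fun j => x (i.succAbove j), ?_⟩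
      simp only [Bool.false_eq_true, if_false]
      rw [← h]; exact Fin.insertNth_self_removeNth i x
  refine (dimH_mono hsub).trans ?_
  rw [dimH_iUnion]
  refine iSup_le fun q => ?_
  have : ContDiff ℝ 1 (fun y : Fin n → ℝ =>
      (Fin.insertNth q.1 (if q.2 then (1:ℝ) else -1) y : Fin (n+1) → ℝ)) := by
    rw [contDiff_pi]
    intro j
    rcases Fin.eq_self_or_eq_succAbove q.1 j with rfl | ⟨j', rfl⟩
    · simpa using contDiff_const
    · simpa using contDiff_apply ℝ ℝ j'
  simpa using this.dimH_range_le

theorem exists_c1_approx {α : Type*} [Fintype α] {n : ℕ} (f : C(Sph n, α → ℝ)) (ε : ℝ)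
    (hε : 0 < ε) : ∃ g : (Fin (n+1) → ℝ) → α → ℝ, ContDiff ℝ 1 g ∧
      ∀ (k : Sph n) (a : α), |g k a - f k a| < ε := by
  let A : Subalgebra ℝ C(Sph n, ℝ) :=
    { carrier := {u | ∃ G : (Fin (n+1) → ℝ) → ℝ, ContDiff ℝ 1 G ∧ ∀ k : Sph n, u k = G k}
      mul_mem' := by
        rintro u v ⟨G, h1, h2⟩ ⟨G', h3, h4⟩
        exact ⟨fun x => G x * G' x, h1.mul h3, fun k => by simp [h2, h4]⟩
      add_mem' := by
        rintro u v ⟨G, h1, h2⟩ ⟨G', h3, h4⟩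
        exact ⟨fun x => G x + G' x, h1.add h3, fun k => by simp [h2, h4]⟩
      algebraMap_mem' := by
        intro r
        exact ⟨fun _ => r, contDiff_const, fun k => by simp⟩ }
  have hA : A.SeparatesPoints := by
    intro x y hxy
    have : ∃ i, x.1 i ≠ y.1 i := by
      by_contra hc; push Not at hc
      exact hxy (Subtype.ext (funext hc))
    obtain ⟨i, hi⟩ := this
    refine ⟨fun k => k.1 i, ⟨⟨fun k => k.1 i, (continuous_apply i).comp continuous_subtype_val⟩, ⟨fun x => x i, ?_, fun k => rfl⟩, rfl⟩, hi⟩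
    exact contDiff_apply ℝ ℝ i
  have : ∀ a : α, ∃ G : (Fin (n+1) → ℝ) → ℝ, ContDiff ℝ 1 G ∧ ∀ k : Sph n, |G k - f k a| < ε := by
    intro a
    obtain ⟨⟨u, G, h1, h2⟩, h3⟩ :=
      ContinuousMap.exists_mem_subalgebra_near_continuous_of_separatesPoints A hA
        (fun k => f k a) (by fun_prop) ε hε
    refine ⟨G, h1, fun k => ?_⟩
    rw [← h2]; exact h3 k
  choose G h1 h2 using this
  exact ⟨fun x a => G a x, contDiff_pi.2 h1, fun k a => h2 a k⟩

theorem sreal_avoid {α : Type*} [Fintype α] [DecidableEq α] {n d : ℕ} (hnd : n + 2 ≤ d)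
    {Δ : Finset α → Prop} (F : Finset α) (hF : F.card = d)
    (hΔ : ∀ σ, Δ σ → ¬ F ⊆ σ) (f : C(Sph n, SReal (fun σ => Δ σ ∨ σ ⊆ F))) :
    ∃ h : C(Sph n, SReal (fun σ => Δ σ ∨ σ ⊆ F)), f.Homotopic h ∧
      ∃ p : α → ℝ, (∀ a, a ∉ F → p a = 0) ∧ (∀ a ∈ F, 0 < p a) ∧ ∑ a, p a = 1 ∧
        ∀ k, (h k).1 ≠ p := by
  have hne : F.Nonempty := Finset.card_pos.1 (by omega)
  obtain ⟨e0, he0⟩ := hne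
  have hd0 : (0:ℝ) < d := by exact_mod_cast (by omega : 0 < d)
  set ε : ℝ := 1 / (8 * d) with hε
  have hεp : 0 < ε := by positivity
  have hεd : 8 * ε = 1 / d := by rw [hε]; field_simp
  set F' := F.erase e0 with hF'
  have hF'c : (F'.card : ℝ) = d - 1 := by
    rw [hF', Finset.card_erase_of_mem he0, hF, Nat.cast_sub (by omega)]; simp
  let P : (α → ℝ) → α → ℝ := fun z a =>
    if a ∈ F' then z a else if a = e0 then 1 - ∑ b ∈ F', z b else 0
  have P1 : ∀ z a, a ∈ F' → P z a = z a := fun z a h => by simp [P, h]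
  have P2 : ∀ z, P z e0 = 1 - ∑ b ∈ F', z b := fun z => by simp [P, hF']
  have P3 : ∀ z a, a ∉ F → P z a = 0 := fun z a h => by
    have h1 : a ∉ F' := fun h' => h (Finset.mem_of_mem_erase h')
    have h2 : a ≠ e0 := fun h' => h (h' ▸ he0)
    simp [P, h1, h2]
  have PFsum : ∀ z, ∑ a, P z a = 1 := by
    intro z
    rw [← Finset.sum_subset (Finset.subset_univ F) (fun a _ h => P3 z a h),
      ← Finset.add_sum_erase F _ he0, P2, Finset.sum_congr rfl (fun a h => P1 z a h)]
    ring
  have Pclose : ∀ (z w : α → ℝ) (δ : ℝ), (∀ a, |z a - w a| ≤ δ / d) → (∑ a ∈ F, w a = 1) →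
      ∀ a ∈ F, |P z a - w a| ≤ δ := by
    intro z w δ h1 h2 a ha
    have hδ : 0 ≤ δ := by
      have := (abs_nonneg _).trans (h1 a)
      rw [le_div_iff₀ hd0] at this; linarith
    by_cases hae : a = e0
    · subst hae
      rw [P2]
      have : w a = 1 - ∑ b ∈ F', w b := by
        rw [← h2, ← Finset.add_sum_erase F _ ha]; ring
      rw [this, show 1 - ∑ b ∈ F', z b - (1 - ∑ b ∈ F', w b) = - ∑ b ∈ F', (z b - w b) by
        rw [Finset.sum_sub_distrib]; ring, abs_neg]
      refine (Finset.abs_sum_le_sum_abs _ _).trans ?_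
      refine (Finset.sum_le_card_nsmul _ _ _ (fun b _ => h1 b)).trans ?_
      rw [nsmul_eq_mul, hF'c, ← mul_div_assoc, div_le_iff₀ hd0]
      nlinarith
    · rw [P1 z a (Finset.mem_erase.2 ⟨hae, ha⟩)]
      refine (h1 a).trans (div_le_self hδ ?_)
      exact_mod_cast (by omega : 1 ≤ d)
  obtain ⟨g, gc, hg⟩ := exists_c1_approx (⟨fun k => (f k).1, by fun_prop⟩ : C(Sph n, α → ℝ))
    ((ε/2) / d) (by positivity)
  -- the missed point
  obtain ⟨q, hq1, hq2⟩ : ∃ q : F' → ℝ, (∀ a, |q a - 1/d| < ε / d) ∧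
      ∀ k : Sph n, (fun a : F' => g k a) ≠ q := by
    have hgc : ContDiff ℝ 1 (fun (x : Fin (n+1) → ℝ) (a : F') => g x a) := by
      rw [contDiff_pi]; intro a
      exact (contDiff_pi.1 gc) a
    have hdim : dimH (Sph n) < (Module.finrank ℝ (F' → ℝ) : ENNReal) := by
      refine (dimH_sph n).trans_lt ?_
      have : n < F'.card := by
        rw [hF', Finset.card_erase_of_mem he0]; omega
      simpa using this
    have hdense := hgc.contDiffOn.dense_compl_image_of_dimH_lt_finrank convex_univ
      (Set.subset_univ (Sph n)) hdim
    obtain ⟨q, hq, hqd⟩ := hdense.exists_dist_lt (fun _ => 1/(d:ℝ)) (by positivity : 0 < ε / d)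
    refine ⟨q, fun a => ?_, fun k hk => hq ⟨k, k.2, hk⟩⟩
    rw [dist_comm] at hqd
    exact (dist_le_pi_dist q (fun _ => 1/(d:ℝ)) a).trans_lt hqd
  let qe : α → ℝ := fun a => if h : a ∈ F' then q ⟨a, h⟩ else 1/d
  let p : α → ℝ := P qe
  have hpF : ∀ a ∈ F, 7 * ε ≤ p a := by
    intro a ha
    have := Pclose qe (fun _ => 1/d) ε (fun b => by
      by_cases h : b ∈ F'
      · simp only [qe, h, dite_true]; exact (hq1 _).le
      · simp only [qe, h, dite_false, sub_self, abs_zero]; positivity) (by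
        rw [Finset.sum_const, hF, nsmul_eq_mul]; field_simp) a ha
    rw [abs_le] at this
    have := this.1
    rw [← hεd] at this
    simp only [p]; linarith
  -- the bump
  let m : Sph n → ℝ := fun k => F.inf' ⟨e0, he0⟩ (fun a => (f k).1 a)
  have mc : Continuous m := by
    apply Continuous.finset_inf'_apply
    intro a ha; exact sreal_cont f a
  have mle : ∀ k, ∀ a ∈ F, m k ≤ (f k).1 a := fun k a ha => Finset.inf'_le _ ha
  have mmin : ∀ k, ∃ a ∈ F, m k = (f k).1 a := fun k =>
    Finset.exists_mem_eq_inf' ⟨e0, he0⟩ (fun a => (f k).1 a)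
  let φ : Sph n → ℝ := fun k => max 0 (min 1 ((m k - ε) / ε))
  have φc : Continuous φ := by
    refine continuous_const.max (continuous_const.min ?_)
    exact (mc.sub continuous_const).div_const _
  have φ0 : ∀ k, 0 ≤ φ k := fun k => le_max_left _ _
  have φ1 : ∀ k, φ k ≤ 1 := fun k => max_le zero_le_one (min_le_left _ _)
  have φz : ∀ k, m k ≤ ε → φ k = 0 := by
    intro k h
    apply max_eq_left
    refine (min_le_right _ _).trans ?_
    exact div_nonpos_of_nonpos_of_nonneg (by linarith) hεp.le
  have φo : ∀ k, 2 * ε ≤ m k → φ k = 1 := by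
    intro k h
    have : 1 ≤ (m k - ε) / ε := by rw [le_div_iff₀ hεp]; linarith
    simp only [φ]
    rw [min_eq_left this]; simp
  have supp : ∀ k, ε < m k → ∀ a, (f k).1 a ≠ 0 → a ∈ F := by
    intro k hk a ha
    obtain ⟨σ, h1 | h1, h2⟩ := (f k).2.2.2
    · exact (hΔ σ h1 (fun b hb => h2 b (by have := mle k b hb; intro h; linarith))).elim
    · exact h1 (h2 a ha)
  have close : ∀ k : Sph n, ε < m k → ∀ a ∈ F, |P (g k) a - (f k).1 a| ≤ ε / 2 := by
    intro k hk
    refine Pclose _ _ _ (fun a => (hg k a).le) ?_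
    refine Eq.trans ?_ (f k).2.2.1
    refine Finset.sum_subset (Finset.subset_univ F) (fun a _ h => ?_)
    by_contra h'; exact h (supp k hk a h')
  let h0 : Sph n → α → ℝ := fun k a => (f k).1 a + φ k * (P (g k) a - (f k).1 a)
  have h0z : ∀ k, m k ≤ ε → h0 k = (f k).1 := by
    intro k hk; funext a; simp [h0, φz k hk]
  have h0F : ∀ k, ε < m k → ∀ a, h0 k a ≠ 0 → a ∈ F := by
    intro k hk a ha
    by_contra hc
    have h1 : (f k).1 a = 0 := by by_contra h; exact hc (supp k hk a h)
    exact ha (by simp [h0, h1, P3 _ _ hc])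
  have h0close : ∀ k, ∀ a ∈ F, |h0 k a - (f k).1 a| ≤ ε / 2 := by
    intro k a ha
    rcases le_or_gt (m k) ε with hk | hk
    · rw [h0z k hk]; simp; positivity
    · simp only [h0, add_sub_cancel_left, abs_mul, abs_of_nonneg (φ0 k)]
      have := close k hk a ha
      have h1 := φ1 k
      have h2 := φ0 k
      have h3 := abs_nonneg (P (g k) a - (f k).1 a)
      nlinarith
  have Pc : Continuous (fun k : Sph n => P (g k)) := by
    have hgc := gc.continuous
    apply continuous_pi
    intro a
    simp only [P]
    split_ifs
    · fun_prop
    · fun_prop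
    · fun_prop
  refine ⟨⟨fun k => ⟨h0 k, ?_, ?_, ?_⟩, ?_⟩, ?_, p, fun a ha => P3 _ a ha, fun a ha => ?_, PFsum _, ?_⟩
  · intro a
    rcases le_or_gt (m k) ε with hk | hk
    · rw [h0z k hk]; exact (f k).2.1 a
    · by_cases ha : a ∈ F
      · have h1 := abs_le.1 (h0close k a ha)
        have h2 := mle k a ha
        linarith [h1.1]
      · by_contra hc
        exact ha (h0F k hk a (by intro h; rw [h] at hc; exact hc le_rfl))
  · simp only [h0]
    rw [Finset.sum_add_distrib, ← Finset.mul_sum, Finset.sum_sub_distrib, PFsum, (f k).2.2.1]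
    ring
  · rcases le_or_gt (m k) ε with hk | hk
    · rw [h0z k hk]; exact (f k).2.2.2
    · exact ⟨F, Or.inr subset_rfl, h0F k hk⟩
  · apply Continuous.subtype_mk
    apply continuous_pi
    intro a
    have := (continuous_apply a).comp Pc
    simp only [Function.comp_def] at this
    exact (sreal_cont f a).add (φc.mul (this.sub (sreal_cont f a)))
  · apply sreal_homotopic
    intro k
    rcases le_or_gt (m k) ε with hk | hk
    · obtain ⟨σ, h1, h2⟩ := (f k).2.2.2
      refine ⟨σ, h1, h2, ?_⟩
      change ∀ a, h0 k a ≠ 0 → a ∈ σ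
      rw [h0z k hk]; exact h2
    · exact ⟨F, Or.inr subset_rfl, supp k hk, h0F k hk⟩
  · have := hpF a ha; linarith
  · intro k hk
    change h0 k = p at hk
    rcases le_or_gt (2 * ε) (m k) with hm | hm
    · apply hq2 k
      funext a
      have h1 := congrFun hk a
      simp only [h0, φo k hm, one_mul, add_sub_cancel, p] at h1
      rw [P1 _ _ a.2, P1 _ _ a.2] at h1
      rw [h1]
      simp only [qe]
      rw [dif_pos a.2]
    · obtain ⟨a, ha, hma⟩ := mmin k
      have h1 := abs_le.1 (h0close k a ha)
      have h2 := hpF a ha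
      rw [← hk] at h2
      linarith [h1.2]

theorem sph_nonempty (n : ℕ) : Nonempty (Sph n) :=
  ⟨⟨fun _ => 1, by
    rw [mem_sphere_zero_iff_norm, pi_norm_const]; simp⟩⟩

theorem shell_null {α : Type*} [Fintype α] [DecidableEq α] {n d : ℕ} (hnd : n + 2 ≤ d)
    {Δ : Finset α → Prop} (h : Shell d Δ) :
    ∀ f : C(Sph n, SReal Δ), f.Nullhomotopic := by
  obtain ⟨k0⟩ := sph_nonempty n
  induction h with
  | void =>
    intro f
    obtain ⟨σ, h1, _⟩ := (f k0).2.2.2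
    exact h1.elim
  | step Δ F R hs hF hR hd ih =>
    have hher := hs.hered
    -- reduce to a map into the smaller complex
    have key : ∀ f h : C(Sph n, SReal (fun σ => Δ σ ∨ σ ⊆ F)), f.Homotopic h →
        (∃ g : C(Sph n, SReal Δ), h.Homotopic ((srealIncl (fun _ h => Or.inl h)).comp g)) →
        f.Nullhomotopic := by
      rintro f h h1 ⟨g, h2⟩
      obtain ⟨y, hy⟩ := (ih g).comp_right (srealIncl (Δ' := fun σ => Δ σ ∨ σ ⊆ F) (fun _ h => Or.inl h))
      exact ⟨y, (h1.trans h2).trans hy⟩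
    intro f
    rcases R.eq_empty_or_nonempty with rfl | hne
    · have hΔ : ∀ σ, ¬ Δ σ := fun σ hσ =>
        (hd ∅ (Finset.empty_subset _)).1 (hher _ _ hσ (Finset.empty_subset _)) subset_rfl
      have hsupp : ∀ k a, (f k).1 a ≠ 0 → a ∈ F := by
        intro k a ha
        obtain ⟨σ, h1 | h1, h2⟩ := (f k).2.2.2
        · exact (hΔ _ h1).elim
        · exact h1 (h2 a ha)
      exact ⟨f k0, sreal_homotopic _ _ (fun k => ⟨F, Or.inr subset_rfl, hsupp k, hsupp k0⟩)⟩
    by_cases hRF : R = F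
    · subst hRF
      obtain ⟨h, h1, p, p0, pR, psum, hp⟩ := sreal_avoid hnd R hF
        (fun σ hσ hRσ => (hd R subset_rfl).1 (hher _ _ hσ hRσ) subset_rfl) f
      refine key f h h1 (sreal_push R R hher subset_rfl hne hd h p p0 pR
        (fun a ha => (p0 a ha).le) ?_)
      intro k
      rw [psum, mul_one]
      by_contra hc
      push Not at hc
      have hge : ∀ a, p a ≤ (h k).1 a := by
        intro a
        by_cases ha : a ∈ R
        · have h2 := hc.trans (Finset.inf'_le (fun a => (h k).1 a / p a) ha)
          rw [le_div_iff₀ (pR a ha)] at h2; linarith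
        · rw [p0 a ha]; exact (h k).2.1 a
      apply hp k
      have hsum : ∑ a, p a = ∑ a, (h k).1 a := by rw [psum, (h k).2.2.1]
      have := (Finset.sum_eq_sum_iff_of_le (fun a _ => hge a)).1 hsum
      funext a; exact (this a (Finset.mem_univ a)).symm
    · have hlt : (F \ R).Nonempty := by
        rw [Finset.sdiff_nonempty]
        exact fun h => hRF (Finset.Subset.antisymm hR h)
      have hpos : (0:ℝ) < (F \ R).card := by exact_mod_cast Finset.card_pos.2 hlt
      let p : α → ℝ := fun a => if a ∈ R then 1 else if a ∈ F \ R then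
        -((R.card : ℝ) / (F \ R).card) else 0
      have psum : ∑ a, p a = 0 := by
        have h1 : ∀ a, a ∉ R ∪ (F \ R) → p a = 0 := by
          intro a ha
          rw [Finset.mem_union] at ha; push Not at ha
          simp only [p, ha, if_false]
        rw [← Finset.sum_subset (Finset.subset_univ (R ∪ (F \ R))) (fun a _ h => h1 a h),
          Finset.sum_union Finset.disjoint_sdiff]
        have h2 : ∑ a ∈ R, p a = R.card := by
          rw [Finset.sum_congr rfl (g := fun _ => (1:ℝ)) (fun a ha => by simp [p, ha])]; simp
        have h3 : ∑ a ∈ F \ R, p a = - R.card := by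
          rw [Finset.sum_congr rfl (g := fun _ => -((R.card : ℝ) / (F \ R).card)) (fun a ha => by
            have : a ∉ R := (Finset.mem_sdiff.1 ha).2
            simp only [p, ha, this, if_true, if_false])]
          rw [Finset.sum_const, nsmul_eq_mul]; field_simp
        rw [h2, h3]; ring
      refine key f f (ContinuousMap.Homotopic.refl _) (sreal_push F R hher hR hne hd f p ?_ ?_ ?_ ?_)
      · intro a ha
        have h1 : a ∉ R := fun h => ha (hR h)
        simp [p, h1, ha]
      · intro a ha; simp [p, ha]
      · intro a ha
        simp only [p, ha, if_false]
        split_ifs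
        · have : 0 ≤ (R.card : ℝ) / (F \ R).card := by positivity
          linarith
        · exact le_rfl
      · intro k; rw [psum]; simp
section homotopy
open unitInterval

theorem extend_ball {X : Type*} [TopologicalSpace X] {n : ℕ} (f : C(Sph n, X))
    (h : f.Nullhomotopic) :
    ∃ G : C(Metric.closedBall (0 : Fin (n+1) → ℝ) 1, X),
      ∀ (z : Metric.closedBall (0 : Fin (n+1) → ℝ) 1) (hz : z.1 ∈ Sph n), G z = f ⟨z.1, hz⟩ := by
  obtain ⟨y, ⟨N'⟩⟩ := h
  let N := N'.symm
  obtain ⟨k0⟩ := sph_nonempty n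
  have hn : ∀ (k : Sph n), ‖k.1‖ = 1 := fun k => mem_sphere_zero_iff_norm.1 k.2
  let π : C(I × Sph n, Metric.closedBall (0 : Fin (n+1) → ℝ) 1) :=
    { toFun := fun q => ⟨(q.1 : ℝ) • q.2.1, by
        rw [mem_closedBall_zero_iff, norm_smul, hn, mul_one, Real.norm_of_nonneg q.1.2.1]
        exact q.1.2.2⟩
      continuous_toFun := by
        apply Continuous.subtype_mk
        fun_prop }
  have hπs : Function.Surjective π := by
    intro z
    have hz1 : ‖z.1‖ ≤ 1 := mem_closedBall_zero_iff.1 z.2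
    by_cases hz : z.1 = 0
    · refine ⟨(0, k0), Subtype.ext ?_⟩
      simp [π, hz]
    · have h0 : ‖z.1‖ ≠ 0 := norm_ne_zero_iff.2 hz
      refine ⟨(⟨‖z.1‖, norm_nonneg _, hz1⟩, ⟨‖z.1‖⁻¹ • z.1, ?_⟩), Subtype.ext ?_⟩
      · rw [mem_sphere_zero_iff_norm, norm_smul, norm_inv, norm_norm, inv_mul_cancel₀ h0]
      · simp [π, smul_smul, mul_inv_cancel₀ h0]
  have hq : Topology.IsQuotientMap π := Topology.IsQuotientMap.of_surjective_continuous hπs π.continuous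
  have hlift : Function.FactorsThrough N.toContinuousMap π := by
    rintro ⟨s, k⟩ ⟨s', k'⟩ heq
    have heq' : (s : ℝ) • k.1 = (s' : ℝ) • k'.1 := congrArg Subtype.val heq
    have hs : (s : ℝ) = s' := by
      have := congrArg norm heq'
      rwa [norm_smul, norm_smul, hn, hn, mul_one, mul_one, Real.norm_of_nonneg s.2.1,
        Real.norm_of_nonneg s'.2.1] at this
    have hs' : s = s' := Subtype.ext hs
    subst hs'
    by_cases h0 : s = 0
    · subst h0
      change N (0, k) = N (0, k')
      rw [N.apply_zero, N.apply_zero]; rfl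
    · have h0' : (s : ℝ) ≠ 0 := fun h => h0 (Subtype.ext h)
      have : k = k' := Subtype.ext (smul_right_injective _ h0' heq')
      rw [this]
  refine ⟨hq.lift N.toContinuousMap hlift, fun z hz => ?_⟩
  have hz' : z = π (1, ⟨z.1, hz⟩) := Subtype.ext (by simp [π])
  have h1 : (hq.lift N.toContinuousMap hlift) (π (1, ⟨z.1, hz⟩)) = N (1, ⟨z.1, hz⟩) :=
    congrArg (fun F : C(I × Sph n, X) => F (1, ⟨z.1, hz⟩)) (hq.lift_comp N.toContinuousMap hlift)
  rw [N.apply_one] at h1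
  rw [← h1, ← hz']

theorem pi_subsingleton {X : Type*} [TopologicalSpace X] (n : ℕ)
    (h : ∀ f : C(Sph n, X), f.Nullhomotopic) (x : X) :
    Subsingleton (HomotopyGroup (Fin n) X x) := by
  have main : ∀ f : GenLoop (Fin n) X x, GenLoop.Homotopic f GenLoop.const := by
    intro f
    let pr : (Fin (n+1) → ℝ) → (Fin n → I) := fun z j =>
      Set.projIcc (0:ℝ) 1 zero_le_one ((z j.succ + 1) / 2)
    have prc : Continuous pr := by
      apply continuous_pi; intro j
      exact continuous_projIcc.comp (by fun_prop)
    have prb : ∀ z, (∃ j : Fin n, |z j.succ| = 1) → f (pr z) = x := by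
      rintro z ⟨j, hj⟩
      apply f.2
      refine ⟨j, ?_⟩
      rcases (abs_eq one_pos.le).1 hj with h | h
      · right; simp [pr, h]
      · left; simp [pr, h]
    let F0 : Sph n → X := fun z => if z.1 0 ≤ -1 then f (pr z.1) else x
    have c0 : ∀ i, Continuous (fun z : Sph n => z.1 i) := fun i =>
      (continuous_apply i).comp continuous_subtype_val
    have F0c : Continuous F0 := by
      refine Continuous.if ?_ (f.1.continuous.comp (prc.comp continuous_subtype_val)) continuous_const
      intro z hz
      rw [frontier_eq_closure_inter_closure] at hz
      have hcl : IsClosed {z : Sph n | z.1 0 ≤ -1} := isClosed_le (c0 0) continuous_const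
      have h1 : z.1 0 ≤ -1 := by simpa using hcl.closure_subset hz.1
      have hclB : IsClosed ({z : Sph n | z.1 0 = 1} ∪ ⋃ j : Fin n, {z : Sph n | |z.1 j.succ| = 1}) := by
        refine (isClosed_eq (c0 0) continuous_const).union (isClosed_iUnion_of_finite fun j => ?_)
        exact isClosed_eq (c0 _).abs continuous_const
      have hsub : {z : Sph n | z.1 0 ≤ -1}ᶜ ⊆
          ({z : Sph n | z.1 0 = 1} ∪ ⋃ j : Fin n, {z : Sph n | |z.1 j.succ| = 1}) := by
        intro w hw
        have hw' : ¬ w.1 0 ≤ -1 := hw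
        obtain ⟨i, hi⟩ := sph_coord w.2
        rcases Fin.eq_zero_or_eq_succ i with rfl | ⟨j, rfl⟩
        · left
          rcases (abs_eq one_pos.le).1 hi with h | h
          · exact h
          · exact absurd h.le hw'
        · right; exact Set.mem_iUnion.2 ⟨j, hi⟩
      rcases closure_minimal hsub hclB hz.2 with h2 | h2
      · have h2' : z.1 0 = 1 := h2
        linarith
      · exact prb z.1 (by simpa using h2)
    obtain ⟨G, hG⟩ := extend_ball ⟨F0, F0c⟩ (h _)
    let zz : I × (Fin n → I) → (Fin (n+1) → ℝ) := fun q =>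
      Fin.cons (2 * (q.1 : ℝ) - 1) (fun j => 2 * (q.2 j : ℝ) - 1)
    have zzc : Continuous zz := by
      apply continuous_pi
      intro i
      refine Fin.cases ?_ (fun j => ?_) i
      · simp only [zz, Fin.cons_zero]; fun_prop
      · simp only [zz, Fin.cons_succ]; fun_prop
    have zzle : ∀ q i, |zz q i| ≤ 1 := by
      intro q i
      have key : ∀ s : I, |2 * (s : ℝ) - 1| ≤ 1 := fun s => by
        rw [abs_le]; have h1 := s.2.1; have h2 := s.2.2; constructor <;> linarith
      refine Fin.cases ?_ (fun j => ?_) i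
      · simpa [zz] using key q.1
      · simpa [zz] using key (q.2 j)
    have zzb : ∀ q, zz q ∈ Metric.closedBall (0 : Fin (n+1) → ℝ) 1 := by
      intro q
      rw [mem_closedBall_zero_iff, pi_norm_le_iff_of_nonneg zero_le_one]
      exact zzle q
    have zzs : ∀ q i, |zz q i| = 1 → zz q ∈ Sph n := by
      intro q i hi
      rw [mem_sphere_zero_iff_norm]
      refine le_antisymm (mem_closedBall_zero_iff.1 (zzb q)) ?_
      rw [← hi]; exact norm_le_pi_norm (zz q) i
    have przz : ∀ q, pr (zz q) = q.2 := by
      intro q; funext j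
      simp only [pr, zz, Fin.cons_succ]
      rw [show (2 * (q.2 j : ℝ) - 1 + 1) / 2 = (q.2 j : ℝ) by ring]
      exact Set.projIcc_val zero_le_one (q.2 j)
    refine ⟨⟨⟨⟨fun q => G ⟨zz q, zzb q⟩, by fun_prop⟩, ?_, ?_⟩, ?_⟩⟩
    · intro y
      have h0 : zz (0, y) 0 = -1 := by simp [zz]
      have hs := zzs (0, y) 0 (by rw [h0]; simp)
      refine (hG _ hs).trans ?_
      change F0 ⟨zz (0, y), hs⟩ = f y
      simp only [F0, h0, le_refl, if_true, przz]
    · intro y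
      have h0 : zz (1, y) 0 = 1 := by simp [zz]; norm_num
      have hs := zzs (1, y) 0 (by rw [h0]; simp)
      refine (hG _ hs).trans ?_
      change F0 ⟨zz (1, y), hs⟩ = x
      simp only [F0, h0]
      rw [if_neg (by norm_num)]
    · intro t y hy
      obtain ⟨j, hj⟩ := id hy
      have h0 : |zz (t, y) j.succ| = 1 := by
        simp only [zz, Fin.cons_succ]
        rcases hj with h | h
        · simp [h]
        · simp [h]; norm_num
      have hs := zzs (t, y) _ h0
      refine (hG _ hs).trans ?_
      change F0 ⟨zz (t, y), hs⟩ = f y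
      rw [GenLoop.boundary f y hy]
      simp only [F0]
      split_ifs
      · exact prb _ ⟨j, h0⟩
      · rfl
  constructor
  intro a b
  induction a using Quotient.inductionOn with | _ f =>
  induction b using Quotient.inductionOn with | _ g =>
  exact Quotient.sound ((main f).trans (main g).symm)

end homotopy

/-- The realization of the forest complex, with or without the empty face. -/
theorem null_forest {V : Type*} [Fintype V] [DecidableEq V] (G : SimpleGraph V) {n d : ℕ}
    (hnd : n + 2 ≤ d) (hs : Shell d (IndepF G)) (f : C(Sph n, SReal (ForestFace G))) :
    f.Nullhomotopic := by
  let j : C(SReal (ForestFace G), SReal (IndepF G)) := srealIncl (fun _ h => h.2)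
  let j' : C(SReal (IndepF G), SReal (ForestFace G)) :=
    { toFun := fun y => ⟨y.1, y.2.1, y.2.2.1, by
        obtain ⟨σ, h1, h2⟩ := y.2.2.2
        refine ⟨σ, ⟨?_, h1⟩, h2⟩
        by_contra hc
        rw [Finset.not_nonempty_iff_eq_empty] at hc
        subst hc
        have h3 : ∀ a, y.1 a = 0 := fun a => by
          by_contra h; exact absurd (h2 a h) (Finset.notMem_empty a)
        have h4 := y.2.2.1
        simp only [h3, Finset.sum_const_zero] at h4
        exact zero_ne_one h4⟩
      continuous_toFun := continuous_subtype_val.subtype_mk _ }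
  exact (shell_null hnd hs (j.comp f)).comp_right j'

theorem forest_complex_connectivity {V : Type*} [Fintype V] [DecidableEq V]
    (G : SimpleGraph V) :
    IsConn ((Fintype.card V : ℤ) - Nat.card G.ConnectedComponent - 2)
      (SReal (ForestFace G)) := by
  obtain ⟨d, hd, hs, σ, hσ, hσd⟩ := forest_shell G
  refine ⟨fun h => ?_, fun i hi x => ?_⟩
  · have hd1 : 1 ≤ d := by omega
    obtain ⟨e, he⟩ := Finset.card_pos.1 (by omega : 0 < σ.card)
    refine ⟨⟨Pi.single e 1, ?_, ?_, σ, ⟨⟨e, he⟩, hσ⟩, ?_⟩⟩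
    · intro a
      by_cases h : a = e
      · subst h; simp
      · simp [h]
    · simp
    · intro a ha
      by_cases h : a = e
      · subst h; exact he
      · simp [h] at ha
  · exact pi_subsingleton i (null_forest G (by omega) hs) x
end
end

section
/- The forest complex F(G) of a finite graph G with n vertices and c components is Cohen-Macaulay of dimension n − c − 1: it is (n − c − 1)-dimensional, (n − c − 2)-connected, and the link of every d-dimensional face is (n − c − d − 2)-dimensional and (n − c − d − 3)-connected. -/
open scoped BigOperators
noncomputable section

/-- The complex with face predicate `P` is `d`-spherical: it has dimension `d`
(faces have at most `d+1` vertices, attained if `d ≥ 0`) and is `(d-1)`-connected. -/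
def IsSpherical {α : Type*} [Fintype α] (d : ℤ) (P : Finset α → Prop) : Prop :=
  (∀ σ, P σ → (σ.card : ℤ) ≤ d + 1) ∧
  (0 ≤ d → ∃ σ, P σ ∧ (σ.card : ℤ) = d + 1) ∧
  IsConn (d - 1) (SReal P)

/-- The link of a face `σ`: faces `τ` disjoint from `σ` with `τ ∪ σ` again a face. -/
def LinkFace {α : Type*} [DecidableEq α] (P : Finset α → Prop) (σ τ : Finset α) : Prop :=
  τ.Nonempty ∧ Disjoint τ σ ∧ P (τ ∪ σ)


/-! ### Graph part -/

section GraphPart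
variable {V : Type*}

theorem fc_card_components_sup_edge [Finite V] (H : SimpleGraph V) (u v : V)
    (h : ¬ H.Reachable u v) :
    Nat.card H.ConnectedComponent
      = Nat.card (H ⊔ SimpleGraph.edge u v).ConnectedComponent + 1 := by
  classical
  set H' := H ⊔ SimpleGraph.edge u v with hH'
  have huv : u ≠ v := fun e => h (e ▸ SimpleGraph.Reachable.refl _)
  have hadj : H'.Adj u v := by
    rw [hH', SimpleGraph.sup_adj]; right; simp [SimpleGraph.edge_adj, huv]
  have hne : H.connectedComponentMk u ≠ H.connectedComponentMk v := by
    intro e; exact h (SimpleGraph.ConnectedComponent.exact e)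
  let φ : V → {C : H.ConnectedComponent // C ≠ H.connectedComponentMk v} := fun w =>
    if hw : H.connectedComponentMk w = H.connectedComponentMk v then
      ⟨H.connectedComponentMk u, hne⟩ else ⟨H.connectedComponentMk w, hw⟩
  have hφadj : ∀ a b, H'.Adj a b → φ a = φ b := by
    intro a b hab
    rw [hH', SimpleGraph.sup_adj] at hab
    rcases hab with hab | hab
    · have : H.connectedComponentMk a = H.connectedComponentMk b :=
        SimpleGraph.ConnectedComponent.sound hab.reachable
      simp only [φ, this]
    · rw [SimpleGraph.edge_adj] at hab
      rcases hab with ⟨⟨rfl, rfl⟩ | ⟨rfl, rfl⟩, _⟩ <;> simp [φ]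
  have hφ : ∀ a b (p : H'.Walk a b), p.IsPath → φ a = φ b := by
    intro a b p hp
    clear hp
    induction p with
    | nil => rfl
    | cons hab p ih => exact (hφadj _ _ hab).trans ih
  let e : H'.ConnectedComponent ≃ {C : H.ConnectedComponent // C ≠ H.connectedComponentMk v} :=
    { toFun := SimpleGraph.ConnectedComponent.lift φ hφ
      invFun := fun C => C.1.map (SimpleGraph.Hom.ofLE le_sup_left)
      left_inv := by
        intro C
        induction C using SimpleGraph.ConnectedComponent.ind with
        | _ w =>
          simp only [SimpleGraph.ConnectedComponent.lift_mk, φ]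
          split_ifs with hw
          · simp only [SimpleGraph.ConnectedComponent.map_mk]
            apply SimpleGraph.ConnectedComponent.sound
            have h1 : H.Reachable w v := SimpleGraph.ConnectedComponent.exact hw
            exact hadj.reachable.trans (h1.mono le_sup_left).symm
          · rfl
      right_inv := by
        rintro ⟨C, hC⟩
        induction C using SimpleGraph.ConnectedComponent.ind with
        | _ w =>
          simp only [SimpleGraph.ConnectedComponent.map_mk,
            SimpleGraph.ConnectedComponent.lift_mk, φ]
          exact dif_neg hC }
  rw [Nat.card_congr e]
  have := Fintype.ofFinite H.ConnectedComponent
  rw [Nat.card_eq_fintype_card, Nat.card_eq_fintype_card]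
  have hpos : 0 < Fintype.card H.ConnectedComponent :=
    Fintype.card_pos_iff.2 ⟨H.connectedComponentMk v⟩
  rw [Fintype.card_subtype_compl]
  simp
  omega

theorem fc_fromEdgeSet_insert (s : Set (Sym2 V)) (u v : V) :
    SimpleGraph.fromEdgeSet (insert s(u, v) s)
      = SimpleGraph.fromEdgeSet s ⊔ SimpleGraph.edge u v := by
  ext a b
  simp only [SimpleGraph.sup_adj, SimpleGraph.fromEdgeSet_adj, SimpleGraph.edge_adj,
    Set.mem_insert_iff, Sym2.eq_iff]
  tauto

/-- circle-free subsets of edges of `G`, possibly empty -/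
def FInd (G : SimpleGraph V) (σ : Finset (Sym2 V)) : Prop :=
  (σ : Set (Sym2 V)) ⊆ G.edgeSet ∧ (SimpleGraph.fromEdgeSet (σ : Set (Sym2 V))).IsAcyclic

theorem FInd.mono {G : SimpleGraph V} {σ τ : Finset (Sym2 V)} (h : FInd G σ) (hτ : τ ⊆ σ) :
    FInd G τ :=
  ⟨fun _ hx => h.1 (hτ hx), h.2.anti (SimpleGraph.fromEdgeSet_mono (by exact_mod_cast hτ))⟩

theorem FInd.card [Fintype V] [DecidableEq V] {G : SimpleGraph V} {σ : Finset (Sym2 V)}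
    (h : FInd G σ) :
    σ.card + Nat.card (SimpleGraph.fromEdgeSet (σ : Set (Sym2 V))).ConnectedComponent
      = Fintype.card V := by
  induction σ using Finset.induction_on with
  | empty =>
    simp only [Finset.card_empty, zero_add, Finset.coe_empty, SimpleGraph.fromEdgeSet_empty]
    rw [← Nat.card_eq_fintype_card]
    refine (Nat.card_congr (Equiv.ofBijective
      (fun v => (⊥ : SimpleGraph V).connectedComponentMk v) ⟨?_, ?_⟩)).symm
    · intro a b hab
      have := SimpleGraph.ConnectedComponent.exact hab
      simpa using this
    · intro C
      induction C using SimpleGraph.ConnectedComponent.ind with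
      | _ w => exact ⟨w, rfl⟩
  | insert e s hes ih =>
    have ih := ih (h.mono (Finset.subset_insert _ _))
    induction e using Sym2.ind with
    | _ u v =>
      have hG : G.Adj u v := by
        have := h.1 (Finset.mem_coe.2 (Finset.mem_insert_self _ _))
        simpa using this
      have hac := h.2
      rw [Finset.coe_insert, fc_fromEdgeSet_insert] at hac
      rw [SimpleGraph.isAcyclic_sup_fromEdgeSet_iff] at hac
      have hnr : ¬ (SimpleGraph.fromEdgeSet (s : Set (Sym2 V))).Reachable u v := by
        intro hr
        rcases hac.2 hr with h1 | h1
        · exact hG.ne h1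
        · rw [SimpleGraph.fromEdgeSet_adj] at h1
          exact hes h1.1
      have := fc_card_components_sup_edge _ u v hnr
      rw [Finset.card_insert_of_notMem hes, Finset.coe_insert, fc_fromEdgeSet_insert]
      omega

theorem FInd.exists_insert [Fintype V] [DecidableEq V] {G H : SimpleGraph V}
    {σ : Finset (Sym2 V)} (h : FInd G σ) (hH : H ≤ G)
    (hc : Nat.card H.ConnectedComponent + σ.card < Fintype.card V) :
    ∃ e ∈ H.edgeSet, e ∉ σ ∧ FInd G (insert e σ) := by
  by_contra hcon
  push Not at hcon
  have hcard := h.card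
  set A := SimpleGraph.fromEdgeSet (σ : Set (Sym2 V)) with hA
  have key : ∀ a b, H.Adj a b → A.Reachable a b := by
    intro a b hab
    by_contra hr
    refine hcon s(a, b) hab ?_ ⟨?_, ?_⟩
    · intro hm
      exact hr (SimpleGraph.Adj.reachable
        ((SimpleGraph.fromEdgeSet_adj _).2 ⟨hm, hab.ne⟩))
    · rw [Finset.coe_insert]
      exact Set.insert_subset (hH hab) h.1
    · rw [Finset.coe_insert, fc_fromEdgeSet_insert]
      exact SimpleGraph.IsAcyclic.sup_edge_of_not_reachable hr h.2
  have key2 : ∀ a b (p : H.Walk a b), p.IsPath →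
      A.connectedComponentMk a = A.connectedComponentMk b := by
    intro a b p hp
    clear hp
    induction p with
    | nil => rfl
    | cons hab p ih =>
      exact (SimpleGraph.ConnectedComponent.sound (key _ _ hab)).trans ih
  have : Nat.card A.ConnectedComponent ≤ Nat.card H.ConnectedComponent := by
    refine Nat.card_le_card_of_surjective
      (SimpleGraph.ConnectedComponent.lift (A.connectedComponentMk) key2) ?_
    intro C
    induction C using SimpleGraph.ConnectedComponent.ind with
    | _ w => exact ⟨H.connectedComponentMk w, rfl⟩
  omega

theorem FInd.card_le [Fintype V] [DecidableEq V] {G : SimpleGraph V}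
    {σ : Finset (Sym2 V)} (h : FInd G σ) :
    σ.card + Nat.card G.ConnectedComponent ≤ Fintype.card V := by
  have h1 := h.card
  have h2 : SimpleGraph.fromEdgeSet (σ : Set (Sym2 V)) ≤ G := by
    intro a b hab
    rw [SimpleGraph.fromEdgeSet_adj] at hab
    exact h.1 hab.1
  have := SimpleGraph.ConnectedComponent.card_le_card_of_le h2
  omega

theorem FInd.augment [Fintype V] [DecidableEq V] {G : SimpleGraph V}
    {σ τ : Finset (Sym2 V)} (h : FInd G σ) (h' : FInd G τ) (hc : σ.card < τ.card) :
    ∃ e ∈ τ, e ∉ σ ∧ FInd G (insert e σ) := by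
  have h1 := h'.card
  obtain ⟨e, he, h2⟩ := h.exists_insert (H := SimpleGraph.fromEdgeSet (τ : Set (Sym2 V)))
    (by
      intro a b hab
      rw [SimpleGraph.fromEdgeSet_adj] at hab
      exact h'.1 hab.1) (by omega)
  rw [SimpleGraph.edgeSet_fromEdgeSet] at he
  exact ⟨e, he.1, h2⟩

end GraphPart

/-! ### Spheres and homotopy groups -/

section SpherePart
open scoped unitInterval Topology

/-- the sup-norm sphere of dimension `i` -/
abbrev FSph (i : ℕ) : Type := {x : Fin (i + 1) → ℝ // ‖x‖ = 1}

/-- every map of the `i`-sphere is freely nullhomotopic -/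
def NullS (i : ℕ) (X : Type*) [TopologicalSpace X] : Prop :=
  ∀ g : C(FSph i, X), g.Nullhomotopic

theorem fsph_exists {i : ℕ} (x : FSph i) : ∃ j, |x.1 j| = 1 := by
  obtain ⟨x, hx⟩ := x
  simp only
  obtain ⟨j, -, hj⟩ := Finset.exists_mem_eq_sup' Finset.univ_nonempty (fun j => ‖x j‖)
  refine ⟨j, le_antisymm ?_ ?_⟩
  · rw [← hx, ← Real.norm_eq_abs]
    exact norm_le_pi_norm _ _
  · rw [← Real.norm_eq_abs, ← hj, ← hx]
    refine (pi_norm_le_iff_of_nonempty _).2 fun k => ?_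
    exact Finset.le_sup' (fun j => ‖x j‖) (Finset.mem_univ k)

theorem NullS.extend {i : ℕ} {X : Type*} [TopologicalSpace X] (h : NullS i X)
    (g : C(FSph i, X)) : ∃ E : C(Fin (i + 1) → ℝ, X), ∀ x : FSph i, E x.1 = g x := by
  classical
  obtain ⟨z, ⟨H⟩⟩ := h g
  have hpos : ∀ y : Fin (i+1) → ℝ, ¬ (‖y‖ ≤ 1/2) → y ≠ 0 := by
    rintro y hy rfl; simp at hy
  let e0 : FSph i := ⟨fun _ => 1, by simp⟩
  let rad : (Fin (i+1) → ℝ) → FSph i := fun y =>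
    if hy : y = 0 then e0 else ⟨‖y‖⁻¹ • y, by
      rw [norm_smul, norm_inv, norm_norm, inv_mul_cancel₀ (norm_ne_zero_iff.2 hy)]⟩
  have hrad : ContinuousOn rad {y | 1/2 ≤ ‖y‖} := by
    rw [continuousOn_iff_continuous_domRestrict, continuous_induced_rng]
    have : (Subtype.val ∘ Set.domRestrict {y : Fin (i+1) → ℝ | 1/2 ≤ ‖y‖} rad)
        = fun y => ‖y.1‖⁻¹ • y.1 := by
      funext y
      have hy : y.1 ≠ 0 := by
        intro h0
        have := y.2
        simp [h0] at this
        norm_num at this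
      simp [rad, hy, Set.domRestrict]
    rw [this]
    refine Continuous.smul (Continuous.inv₀ continuous_subtype_val.norm ?_) continuous_subtype_val
    intro y h0
    have := y.2
    simp only [Set.mem_ofPred_eq] at this
    linarith
  let tm : (Fin (i+1) → ℝ) → I := fun y => Set.projIcc 0 1 zero_le_one (2 - 2 * ‖y‖)
  have htm : Continuous tm := continuous_projIcc.comp (by fun_prop)
  refine ⟨⟨fun y => if ‖y‖ ≤ 1/2 then z else H (tm y, rad y), ?_⟩, ?_⟩
  · refine continuous_if_le (by fun_prop) (by fun_prop) (by fun_prop) ?_ ?_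
    · exact H.continuous.comp_continuousOn (htm.continuousOn.prodMk hrad)
    · intro y hy
      have : tm y = 1 := by
        simp only [tm, hy]
        rw [Set.projIcc_of_right_le]
        · rfl
        · norm_num
      rw [this, H.apply_one]
      rfl
  · intro x
    have hx : ¬ (‖x.1‖ ≤ 1/2) := by rw [x.2]; norm_num
    have h1 : tm x.1 = 0 := by
      simp only [tm, x.2]
      rw [Set.projIcc_of_le_left]
      · rfl
      · norm_num
    have h2 : rad x.1 = x := by
      have := hpos _ hx
      simp only [rad, this, dite_false]
      apply Subtype.ext
      simp [x.2]
    simp only [ContinuousMap.coe_mk, hx, if_false, h1, h2, H.apply_zero]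

theorem NullS.subsingleton {i : ℕ} {X : Type*} [TopologicalSpace X] (h : NullS i X) (x : X) :
    Subsingleton (HomotopyGroup (Fin i) X x) := by
  suffices hs : ∀ f : GenLoop (Fin i) X x, GenLoop.Homotopic f GenLoop.const by
    constructor
    intro a b
    induction a using Quotient.inductionOn with
    | _ a =>
      induction b using Quotient.inductionOn with
      | _ b => exact Quotient.sound ((hs a).trans (hs b).symm)
  intro f
  let cub : (Fin (i+1) → ℝ) → (Fin i → I) := fun y j =>
    Set.projIcc 0 1 zero_le_one ((1 + y j.succ) / 2)
  have hcub : Continuous cub := by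
    refine continuous_pi fun j => continuous_projIcc.comp (by fun_prop)
  have hbd : ∀ (y : Fin (i+1) → ℝ) (j : Fin i), |y j.succ| = 1 → f (cub y) = x := by
    intro y j hj
    refine f.2 _ ⟨j, ?_⟩
    rcases (abs_eq zero_le_one).1 hj with h1 | h1
    · right
      simp only [cub, h1]
      rw [Set.projIcc_of_right_le]
      · rfl
      · norm_num
    · left
      simp only [cub, h1]
      rw [Set.projIcc_of_le_left]
      · rfl
      · norm_num
  have hcont : Continuous (fun y : FSph i => if y.1 0 ≤ 0 then f (cub y.1) else x) := by
    refine Continuous.if_le ?_ (by fun_prop) ?_ (by fun_prop) ?_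
    · exact f.1.continuous.comp (hcub.comp continuous_subtype_val)
    · exact (continuous_apply 0).comp continuous_subtype_val
    · intro y hy
      obtain ⟨j, hj⟩ := fsph_exists y
      induction j using Fin.cases with
      | zero => rw [hy] at hj; simp at hj
      | succ j => exact hbd _ j hj
  obtain ⟨E, hE⟩ := h.extend ⟨_, hcont⟩
  let pt : I × (Fin i → I) → (Fin (i+1) → ℝ) := fun p =>
    Fin.cons (2 * (p.1 : ℝ) - 1) (fun j => 2 * (p.2 j : ℝ) - 1)
  have hpt : Continuous pt := by
    refine continuous_pi fun j => ?_
    induction j using Fin.cases with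
    | zero => simp only [pt, Fin.cons_zero]; fun_prop
    | succ j => simp only [pt, Fin.cons_succ]; fun_prop
  have hle : ∀ p, ‖pt p‖ ≤ 1 := by
    intro p
    rw [pi_norm_le_iff_of_nonneg zero_le_one]
    intro j
    rw [Real.norm_eq_abs, abs_le]
    induction j using Fin.cases with
    | zero =>
      have := p.1.2
      simp only [pt, Fin.cons_zero]
      constructor <;> linarith [this.1, this.2]
    | succ j =>
      have := (p.2 j).2
      simp only [pt, Fin.cons_succ]
      constructor <;> linarith [this.1, this.2]
  have hnorm : ∀ p j, |pt p j| = 1 → ‖pt p‖ = 1 := by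
    intro p j hj
    refine le_antisymm (hle p) ?_
    rw [← hj, ← Real.norm_eq_abs]
    exact norm_le_pi_norm _ _
  have hcp : ∀ p, cub (pt p) = p.2 := by
    intro p
    funext j
    simp only [cub, pt, Fin.cons_succ]
    have : (1 + (2 * ((p.2 j : I) : ℝ) - 1)) / 2 = (p.2 j : ℝ) := by ring
    rw [this, Set.projIcc_val]
  have hE' : ∀ p j, |pt p j| = 1 → E (pt p) = if pt p 0 ≤ 0 then f p.2 else x := by
    intro p j hj
    have := hE ⟨pt p, hnorm p j hj⟩
    simpa only [ContinuousMap.coe_mk, hcp] using this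
  refine ⟨⟨⟨⟨fun p => E (pt p), E.continuous.comp hpt⟩, ?_, ?_⟩, ?_⟩⟩
  · intro y
    have h0 : pt (0, y) 0 = -1 := by simp [pt]
    have := hE' (0, y) 0 (by rw [h0]; norm_num)
    rw [h0, if_pos (by norm_num)] at this
    exact this
  · intro y
    have h0 : pt (1, y) 0 = 1 := by simp [pt]; norm_num
    have := hE' (1, y) 0 (by rw [h0]; norm_num)
    rw [h0, if_neg (by norm_num)] at this
    exact this
  · intro t y hy
    have hfx : f y = x := f.2 y hy
    obtain ⟨j, hj⟩ := hy
    have h0 : |pt (t, y) j.succ| = 1 := by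
      rcases hj with hj | hj
      · simp [pt, hj]
      · simp [pt, hj]; norm_num
    have h1 := hE' (t, y) _ h0
    have h2 : E (pt (t, y)) = x := by
      rw [h1]; simp [hfx]
    exact h2.trans hfx.symm

theorem NullS.of_factor {i : ℕ} {X Y : Type*} [TopologicalSpace X] [TopologicalSpace Y]
    (h : NullS i Y) (inc : C(Y, X)) (g : C(FSph i, X)) (g' : C(FSph i, Y))
    (hg : g.Homotopic (inc.comp g')) : g.Nullhomotopic := by
  obtain ⟨z, hz⟩ := h g'
  exact ⟨inc z, hg.trans ((ContinuousMap.Homotopic.refl inc).comp hz)⟩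

theorem fsph_generic {i : ℕ} {ι : Type*} [Fintype ι] (hι : i < Fintype.card ι)
    (u : C(FSph i, ι → ℝ)) {ε : ℝ} (hε : 0 < ε) :
    ∃ w : C(FSph i, ι → ℝ), (∀ y, ‖w y - u y‖ < ε) ∧ Dense (Set.range w)ᶜ := by
  have hcl : Topology.IsClosedEmbedding (Subtype.val : FSph i → (Fin (i+1) → ℝ)) := by
    refine Topology.IsClosedEmbedding.subtypeVal ?_
    exact isClosed_eq continuous_norm continuous_const
  obtain ⟨v, hv⟩ := ContinuousMap.exists_extension hcl u
  obtain ⟨w, hw, hwv, -⟩ := v.continuous.exists_contDiff_approx 1 (ε := fun _ => ε)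
    continuous_const (fun _ => hε)
  refine ⟨⟨fun y => w y.1, hw.continuous.comp continuous_subtype_val⟩, ?_, ?_⟩
  · intro y
    have h1 := hwv y.1
    have h2 : v y.1 = u y := by rw [← hv]; rfl
    rw [h2, dist_eq_norm] at h1
    exact h1
  · apply dense_compl_of_dimH_lt_finrank
    have hsub : Set.range (fun y : FSph i => w y.1) ⊆
        ⋃ q : Fin (i+1) × Bool, Set.range (fun x : Fin i → ℝ =>
          w (q.1.insertNth (if q.2 then (1:ℝ) else -1) x)) := by
      rintro _ ⟨y, rfl⟩
      obtain ⟨j, hj⟩ := fsph_exists y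
      rw [Set.mem_iUnion]
      rcases (abs_eq zero_le_one).1 hj with h1 | h1
      · refine ⟨(j, true), j.removeNth y.1, ?_⟩
        simp only [if_true, ← h1, Fin.insertNth_self_removeNth]
      · refine ⟨(j, false), j.removeNth y.1, ?_⟩
        simp only [Bool.false_eq_true, if_false, ← h1, Fin.insertNth_self_removeNth]
    refine lt_of_le_of_lt (dimH_mono hsub) ?_
    rw [dimH_iUnion]
    refine lt_of_le_of_lt (iSup_le (a := (i : ENNReal)) ?_) ?_
    · intro q
      have hins : ContDiff ℝ 1 (fun x : Fin i → ℝ =>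
          w ((q.1.insertNth (if q.2 then (1:ℝ) else -1) x : Fin (i+1) → ℝ))) := by
        refine ContDiff.comp hw ?_
        rw [contDiff_pi]
        intro j
        induction j using q.1.succAboveCases with
        | x => simp only [Fin.insertNth_apply_same]; exact contDiff_const
        | p j => simp only [Fin.insertNth_apply_succAbove]; exact contDiff_apply ℝ ℝ j
      have := hins.dimH_range_le
      simpa using this
    · simp only [Module.finrank_fintype_fun_eq_card]
      exact_mod_cast hι

end SpherePart

/-! ### Attaching a simplex -/

section AttachPart
open scoped unitInterval Topology

/-- The larger complex is obtained from `K` by attaching the simplex `F` along the faces not containing `R`. -/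
structure Attach {α : Type*} [Fintype α] [DecidableEq α] (K K' : Finset α → Prop)
    (F R : Finset α) : Prop where
  sub : ∀ G, K G → K' G
  cases : ∀ G, K' G → K G ∨ G ⊆ F
  notR : ∀ G, K G → ¬ R ⊆ G
  face : K' F
  del : ∀ a ∈ R, K (F.erase a)
  RF : R ⊆ F
  ne : R.Nonempty

variable {α : Type*} [Fintype α] [DecidableEq α] {K K' : Finset α → Prop} {F R : Finset α}

/-- the inclusion of realizations -/
def Attach.inc (h : Attach K K' F R) : C(SReal K, SReal K') where
  toFun f := ⟨f.1, f.2.1, f.2.2.1, by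
    obtain ⟨S, h1, h2⟩ := f.2.2.2
    exact ⟨S, h.sub _ h1, h2⟩⟩
  continuous_toFun := by fun_prop

/-- the minimal coordinate on `R` -/
def Attach.m (h : Attach K K' F R) (f : SReal K') : ℝ := R.inf' h.ne (fun a => f.1 a)

theorem Attach.m_cont (h : Attach K K' F R) : Continuous h.m := by
  unfold Attach.m
  refine Continuous.finset_inf'_apply h.ne fun a _ => ?_
  exact (continuous_apply a).comp continuous_subtype_val

theorem Attach.m_le (h : Attach K K' F R) (f : SReal K') {a : α} (ha : a ∈ R) :
    h.m f ≤ f.1 a := Finset.inf'_le _ ha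

theorem Attach.m_nonneg (h : Attach K K' F R) (f : SReal K') : 0 ≤ h.m f :=
  Finset.le_inf' _ _ fun a _ => f.2.1 a

theorem Attach.m_attained (h : Attach K K' F R) (f : SReal K') : ∃ a ∈ R, h.m f = f.1 a :=
  Finset.exists_mem_eq_inf' h.ne _

theorem Attach.supp (h : Attach K K' F R) (f : SReal K') (hm : 0 < h.m f) :
    ∀ a, a ∉ F → f.1 a = 0 := by
  intro a ha
  by_contra h0
  obtain ⟨G, hG, hs⟩ := f.2.2.2
  rcases h.cases G hG with h1 | h1
  · refine h.notR G h1 fun b hb => hs b ?_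
    exact (lt_of_lt_of_le hm (h.m_le f hb)).ne'
  · exact ha (h1 (hs a h0))

theorem Attach.homotopy {Z : Type*} [TopologicalSpace Z] (h : Attach K K' F R)
    (g : C(Z, SReal K')) (W : I × Z → α → ℝ) (hW : Continuous W)
    (h0 : ∀ z, W (0, z) = (g z).1) (hpos : ∀ t z a, 0 ≤ W (t, z) a)
    (hsum : ∀ t z, ∑ a, W (t, z) a = 1) (hst : ∀ t z, h.m (g z) = 0 → W (t, z) = (g z).1)
    (hsu : ∀ t z a, 0 < h.m (g z) → a ∉ F → W (t, z) a = 0) :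
    ∃ g1 : C(Z, SReal K'), g.Homotopic g1 ∧ ∀ z, (g1 z).1 = W (1, z) := by
  have hface : ∀ p : I × Z, ∃ S : Finset α, K' S ∧ ∀ a, W p a ≠ 0 → a ∈ S := by
    rintro ⟨t, z⟩
    rcases (h.m_nonneg (g z)).eq_or_lt with hm | hm
    · rw [hst t z hm.symm]
      exact (g z).2.2.2
    · refine ⟨F, h.face, fun a ha => ?_⟩
      by_contra hF
      exact ha (hsu t z a hm hF)
  let Wc : C(I × Z, SReal K') :=
    ⟨fun p => ⟨W p, fun a => hpos p.1 p.2 a, hsum p.1 p.2, hface p⟩, by fun_prop⟩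
  refine ⟨⟨fun z => Wc (1, z), by fun_prop⟩, ⟨⟨Wc, ?_, ?_⟩⟩, fun z => rfl⟩
  · intro z
    exact Subtype.ext (h0 z)
  · intro z
    rfl

theorem Attach.lift {Z : Type*} [TopologicalSpace Z] (h : Attach K K' F R)
    (g : C(Z, SReal K')) (hg : ∀ z, ∃ a ∈ R, (g z).1 a = 0) :
    ∃ g' : C(Z, SReal K), g = h.inc.comp g' := by
  have hface : ∀ z, ∃ S : Finset α, K S ∧ ∀ a, (g z).1 a ≠ 0 → a ∈ S := by
    intro z
    obtain ⟨a, ha, h0⟩ := hg z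
    obtain ⟨G, hG, hs⟩ := (g z).2.2.2
    rcases h.cases G hG with h1 | h1
    · exact ⟨G, h1, hs⟩
    · refine ⟨F.erase a, h.del a ha, fun b hb => Finset.mem_erase.2 ⟨?_, h1 (hs b hb)⟩⟩
      rintro rfl
      exact hb h0
  refine ⟨⟨fun z => ⟨(g z).1, (g z).2.1, (g z).2.2.1, hface z⟩, by fun_prop⟩, ?_⟩
  ext z
  rfl

theorem Attach.collapse (h : Attach K K' F R) (hne : R ≠ F) {i : ℕ} (hK : NullS i (SReal K)) :
    NullS i (SReal K') := by
  intro g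
  obtain ⟨b, hbF, hbR⟩ : ∃ b ∈ F, b ∉ R := by
    by_contra hcon
    push Not at hcon
    exact hne (Finset.Subset.antisymm h.RF hcon)
  let v : α → ℝ := fun a => if a = b then (R.card : ℝ) else if a ∈ R then -1 else 0
  have hv : ∑ a, v a = 0 := by
    have : ∀ a, v a = (if a = b then (R.card : ℝ) else 0) + (if a ∈ R then -1 else 0) := by
      intro a
      by_cases hab : a = b
      · subst hab; simp [v, hbR]
      · simp [v, hab]
    simp only [this, Finset.sum_add_distrib]
    simp
  let W : I × FSph i → α → ℝ := fun p a =>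
    (g p.2).1 a + (p.1 : ℝ) * h.m (g p.2) * v a
  have hmc : Continuous (fun p : I × FSph i => h.m (g p.2)) :=
    h.m_cont.comp (g.continuous.comp continuous_snd)
  have hgc : ∀ a, Continuous (fun p : I × FSph i => (g p.2).1 a) := fun a =>
    (continuous_apply a).comp (continuous_subtype_val.comp (g.continuous.comp continuous_snd))
  have hWc : Continuous W := by
    refine continuous_pi fun a => (hgc a).add (Continuous.mul (Continuous.mul ?_ hmc) ?_)
    · exact continuous_subtype_val.comp continuous_fst
    · exact continuous_const
  obtain ⟨g1, hg1, hv1⟩ := h.homotopy g W hWc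
    (by intro z; funext a; simp [W])
    (by
      intro t z a
      simp only [W, v]
      have h1 := (g z).2.1 a
      have h2 := h.m_nonneg (g z)
      have h3 := t.2.1
      have h4 := t.2.2
      split_ifs with hab haR
      · positivity
      · have := h.m_le (g z) haR
        nlinarith
      · simpa using h1)
    (by
      intro t z
      simp only [W]
      rw [Finset.sum_add_distrib, ← Finset.mul_sum, hv, (g z).2.2.1]
      simp)
    (by intro t z hm; funext a; simp [W, hm])
    (by
      intro t z a hm ha
      have h1 : a ≠ b := by rintro rfl; exact ha hbF
      have h2 : a ∉ R := fun h' => ha (h.RF h')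
      simp [W, v, h1, h2, h.supp _ hm a ha])
  obtain ⟨g', hg'⟩ := h.lift g1 (by
    intro z
    obtain ⟨a, ha, hm⟩ := h.m_attained (g z)
    refine ⟨a, ha, ?_⟩
    rw [hv1]
    have h1 : a ≠ b := by rintro rfl; exact hbR ha
    simp [W, v, h1, ha, hm])
  exact hK.of_factor h.inc g g' (hg' ▸ hg1)

/-- maps missing an interior point of `F` can be pushed into `K` -/
theorem Attach.push (h : Attach K K' F F) {i : ℕ}
    (g : C(FSph i, SReal K')) (p : α → ℝ) (hp : ∀ a ∈ F, 0 < p a) (hp0 : ∀ a, a ∉ F → p a = 0)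
    (hp1 : ∑ a, p a = 1) (hmiss : ∀ z, (g z).1 ≠ p) :
    ∃ g' : C(FSph i, SReal K), g.Homotopic (h.inc.comp g') := by
  let μ : FSph i → ℝ := fun z => F.inf' h.ne (fun a => (g z).1 a / p a)
  have hμc : Continuous μ := by
    refine Continuous.finset_inf'_apply h.ne fun a _ => Continuous.div_const ?_ _
    exact (continuous_apply a).comp (continuous_subtype_val.comp g.continuous)
  have hμ0 : ∀ z, 0 ≤ μ z := fun z => Finset.le_inf' _ _ fun a ha =>
    div_nonneg ((g z).2.1 a) (hp a ha).le
  have hμle : ∀ z, ∀ a, μ z * p a ≤ (g z).1 a := by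
    intro z a
    by_cases ha : a ∈ F
    · rw [← le_div_iff₀ (hp a ha)]
      exact Finset.inf'_le _ ha
    · rw [hp0 a ha, mul_zero]
      exact (g z).2.1 a
  have hμ1 : ∀ z, μ z < 1 := by
    intro z
    by_contra hcon
    push Not at hcon
    have hle : ∀ a ∈ Finset.univ, p a ≤ (g z).1 a := by
      intro a _
      have h1 := hμle z a
      have h2 : 0 ≤ p a := by
        by_cases ha : a ∈ F
        · exact (hp a ha).le
        · exact (hp0 a ha).ge
      nlinarith
    have := (Finset.sum_eq_sum_iff_of_le hle).1 (by rw [hp1, (g z).2.2.1])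
    exact hmiss z (funext fun a => (this a (Finset.mem_univ a)).symm)
  have hμatt : ∀ z, ∃ a ∈ F, (g z).1 a = μ z * p a := by
    intro z
    obtain ⟨a, ha, hm⟩ := Finset.exists_mem_eq_inf' h.ne (fun a => (g z).1 a / p a)
    refine ⟨a, ha, ?_⟩
    have : μ z = (g z).1 a / p a := hm
    rw [this, div_mul_cancel₀ _ (hp a ha).ne']
  have hden : ∀ (t : I) z, 0 < 1 - (t : ℝ) * μ z := by
    intro t z
    have h3 := t.2.1
    have h4 := t.2.2
    nlinarith [hμ0 z, hμ1 z]
  let W : I × FSph i → α → ℝ := fun q a =>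
    ((g q.2).1 a - (q.1 : ℝ) * μ q.2 * p a) / (1 - (q.1 : ℝ) * μ q.2)
  have hgc : ∀ a, Continuous (fun p : I × FSph i => (g p.2).1 a) := fun a =>
    (continuous_apply a).comp (continuous_subtype_val.comp (g.continuous.comp continuous_snd))
  have htm : Continuous (fun q : I × FSph i => (q.1 : ℝ) * μ q.2) :=
    (continuous_subtype_val.comp continuous_fst).mul (hμc.comp continuous_snd)
  have hWc : Continuous W := by
    refine continuous_pi fun a => Continuous.div ?_ ?_ ?_
    · exact (hgc a).sub (htm.mul continuous_const)
    · exact continuous_const.sub htm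
    · intro q
      exact (hden q.1 q.2).ne'
  obtain ⟨g1, hg1, hv1⟩ := h.homotopy g W hWc
    (by intro z; funext a; simp [W])
    (by
      intro t z a
      refine div_nonneg ?_ (hden t z).le
      have h1 := hμle z a
      have h2 := (g z).2.1 a
      have h3 := t.2.1
      have h4 := t.2.2
      simp only
      nlinarith)
    (by
      intro t z
      simp only [W]
      rw [← Finset.sum_div, Finset.sum_sub_distrib, ← Finset.mul_sum, hp1, (g z).2.2.1, mul_one]
      exact div_self (hden t z).ne')
    (by
      intro t z hm
      obtain ⟨a, ha, hma⟩ := h.m_attained (g z)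
      have : μ z = 0 := by
        refine le_antisymm ?_ (hμ0 z)
        have h1 := hμle z a
        rw [← hma, hm] at h1
        have := hp a ha
        by_contra hcon
        push Not at hcon
        nlinarith
      funext b
      simp [W, this])
    (by
      intro t z a hm ha
      simp [W, h.supp _ hm a ha, hp0 a ha])
  obtain ⟨g', hg'⟩ := h.lift g1 (by
    intro z
    obtain ⟨a, ha, hm⟩ := hμatt z
    refine ⟨a, ha, ?_⟩
    rw [hv1]
    simp [W, hm])
  exact ⟨g', hg' ▸ hg1⟩

/-- maps from low-dimensional spheres can be perturbed to miss an interior point of `F` -/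
theorem Attach.perturb (h : Attach K K' F F) {i : ℕ} (hi : i + 2 ≤ F.card)
    (g : C(FSph i, SReal K')) :
    ∃ g1 : C(FSph i, SReal K'), g.Homotopic g1 ∧ ∃ p : α → ℝ, (∀ a ∈ F, 0 < p a) ∧
      (∀ a, a ∉ F → p a = 0) ∧ ∑ a, p a = 1 ∧ ∀ z, (g1 z).1 ≠ p := by
  obtain ⟨c, hc⟩ := h.ne
  let ι := {a // a ∈ F.erase c}
  have hcard : Fintype.card ι + 1 = F.card := by
    rw [Fintype.card_coe, Finset.card_erase_add_one hc]
  obtain ⟨k, hk⟩ : ∃ k : ℝ, k = (F.card : ℝ) := ⟨_, rfl⟩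
  have hk2 : 2 ≤ k := by
    rw [hk]; exact_mod_cast (by omega : 2 ≤ F.card)
  have hk0 : 0 < k := by linarith
  have hcardk : (Fintype.card ι : ℝ) = k - 1 := by
    rw [hk, ← hcard]; push_cast; ring
  -- extension of a vector on `ι` to a vector of sum zero
  let ext : (ι → ℝ) → α → ℝ := fun δ a =>
    if ha : a ∈ F.erase c then δ ⟨a, ha⟩ else if a = c then - ∑ b, δ b else 0
  have hext_sum : ∀ δ, ∑ a, ext δ a = 0 := by
    intro δ
    have h1 : ∀ a, ext δ a = (if ha : a ∈ F.erase c then δ ⟨a, ha⟩ else 0)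
        + (if a = c then - ∑ b, δ b else 0) := by
      intro a
      by_cases ha : a ∈ F.erase c
      · have : a ≠ c := Finset.ne_of_mem_erase ha
        simp only [ext, ha, this, dite_true, if_false, add_zero]
      · simp only [ext, ha, dite_false, zero_add]
    simp only [h1, Finset.sum_add_distrib]
    have h2 : ∑ a, (if ha : a ∈ F.erase c then δ ⟨a, ha⟩ else 0) = ∑ b, δ b := by
      rw [← Finset.sum_subset (Finset.subset_univ (F.erase c))]
      · rw [← Finset.sum_coe_sort (F.erase c)]
        refine Finset.sum_congr rfl fun b _ => ?_
        simp only [b.2, dite_true]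
      · intro a _ ha
        simp only [ha, dite_false]
    rw [h2]
    simp
  have hext_out : ∀ δ a, a ∉ F → ext δ a = 0 := by
    intro δ a ha
    have h1 : a ∉ F.erase c := fun h' => ha (Finset.mem_of_mem_erase h')
    have h2 : a ≠ c := by rintro rfl; exact ha hc
    simp only [ext, h1, h2, dite_false, if_false]
  have hext_cont : Continuous ext := by
    refine continuous_pi fun a => ?_
    by_cases ha : a ∈ F.erase c
    · simp only [ext, ha, dite_true]; fun_prop
    · by_cases hac : a = c
      · simp only [ext, hac, if_true]
        have : c ∉ F.erase c := by simp
        simp only [this, dite_false]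
        fun_prop
      · simp only [ext, ha, hac, dite_false, if_false]; fun_prop
  obtain ⟨ε, hε⟩ : ∃ ε : ℝ, ε = 1 / (4 * k ^ 2) := ⟨_, rfl⟩
  have hε0 : 0 < ε := by rw [hε]; positivity
  have hkε : k * ε = 1 / (4 * k) := by rw [hε]; field_simp
  have hext_abs : ∀ δ : ι → ℝ, ‖δ‖ < ε → ∀ a, |ext δ a| ≤ 1 / (4 * k) := by
    intro δ hδ a
    have h1 : ∀ b, |δ b| ≤ ε := fun b =>
      (Real.norm_eq_abs _ ▸ norm_le_pi_norm δ b).trans hδ.le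
    have hε1 : ε ≤ 1 / (4 * k) := by rw [← hkε]; nlinarith
    by_cases ha : a ∈ F.erase c
    · simp only [ext, ha, dite_true]
      exact (h1 _).trans hε1
    · by_cases hac : a = c
      · simp only [ext, ha, dite_false]
        rw [if_pos hac, abs_neg]
        refine (Finset.abs_sum_le_sum_abs _ _).trans ?_
        refine (Finset.sum_le_sum fun b _ => h1 b).trans ?_
        rw [Finset.sum_const, Finset.card_univ, nsmul_eq_mul, hcardk, ← hkε]
        nlinarith
      · simp only [ext, ha, hac, dite_false, if_false, abs_zero]
        positivity
  let u : C(FSph i, ι → ℝ) := ⟨fun z b => (g z).1 b.1, by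
    refine continuous_pi fun b => ?_
    exact (continuous_apply b.1).comp (continuous_subtype_val.comp g.continuous)⟩
  obtain ⟨w, hw, hdense⟩ := fsph_generic (by omega) u hε0
  let lam : FSph i → ℝ := fun z => max 0 (min 1 (4 * k * h.m (g z) - 1))
  have hlamc : Continuous lam := by
    have := h.m_cont.comp g.continuous
    exact continuous_const.max (continuous_const.min
      ((continuous_const.mul this).sub continuous_const))
  have hlam0 : ∀ z, 0 ≤ lam z := fun z => le_max_left _ _
  have hlam1 : ∀ z, lam z ≤ 1 := fun z => max_le zero_le_one (min_le_left _ _)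
  have hlamz : ∀ z, h.m (g z) ≤ 1 / (4 * k) → lam z = 0 := by
    intro z hz
    refine max_eq_left ((min_le_right _ _).trans ?_)
    rw [le_div_iff₀ (by positivity)] at hz
    linarith
  have hlamo : ∀ z, 1 / (2 * k) ≤ h.m (g z) → lam z = 1 := by
    intro z hz
    rw [div_le_iff₀ (by positivity)] at hz
    have : min 1 (4 * k * h.m (g z) - 1) = 1 := min_eq_left (by linarith)
    simp only [lam, this]
    norm_num
  let D : FSph i → α → ℝ := fun z => ext (w z - u z)
  have hDc : Continuous D := hext_cont.comp (w.continuous.sub u.continuous)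
  have hDabs : ∀ z a, |D z a| ≤ 1 / (4 * k) := fun z a => hext_abs _ (hw z) a
  let W : I × FSph i → α → ℝ := fun q a =>
    (g q.2).1 a + (q.1 : ℝ) * lam q.2 * D q.2 a
  have hgc : ∀ a, Continuous (fun p : I × FSph i => (g p.2).1 a) := fun a =>
    (continuous_apply a).comp (continuous_subtype_val.comp (g.continuous.comp continuous_snd))
  have hWc : Continuous W := by
    refine continuous_pi fun a => (hgc a).add (Continuous.mul (Continuous.mul ?_ ?_) ?_)
    · exact continuous_subtype_val.comp continuous_fst
    · exact hlamc.comp continuous_snd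
    · exact (continuous_apply a).comp (hDc.comp continuous_snd)
  obtain ⟨g1, hg1, hv1⟩ := h.homotopy g W hWc
    (by intro z; funext a; simp [W])
    (by
      intro t z a
      have h1 := (g z).2.1 a
      have h3 := t.2.1
      have h4 := t.2.2
      simp only [W]
      by_cases hm : h.m (g z) ≤ 1 / (4 * k)
      · rw [hlamz z hm]; simpa using h1
      · by_cases ha : a ∈ F
        · push Not at hm
          have h5 := h.m_le (g z) ha
          have h6 := hDabs z a
          have h7 : |(t : ℝ) * lam z * D z a| ≤ 1 / (4 * k) := by
            rw [abs_mul, abs_of_nonneg (mul_nonneg h3 (hlam0 z))]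
            have h8 : (t : ℝ) * lam z ≤ 1 := mul_le_one₀ h4 (hlam0 z) (hlam1 z)
            have h9 := abs_nonneg (D z a)
            nlinarith
          have := (abs_le.1 h7).1
          linarith
        · simp only [D, hext_out _ a ha, mul_zero, add_zero]
          exact h1)
    (by
      intro t z
      simp only [W]
      rw [Finset.sum_add_distrib, ← Finset.mul_sum, (g z).2.2.1, hext_sum]
      simp)
    (by
      intro t z hm
      funext a
      have := hlamz z (by rw [hm]; positivity)
      simp [W, this])
    (by
      intro t z a hm ha
      simp [W, D, hext_out _ a ha, h.supp _ hm a ha])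
  -- choose the point to be missed
  obtain ⟨q, hqU, hqw⟩ : ∃ q : ι → ℝ, (((∀ b, 3 / (4 * k) < q b) ∧ ∑ b, q b < 1 - 3 / (4 * k))) ∧
      q ∈ (Set.range w)ᶜ := by
    have hopen : IsOpen {q : ι → ℝ | (∀ b, 3 / (4 * k) < q b) ∧ ∑ b, q b < 1 - 3 / (4 * k)} := by
      refine IsOpen.and ?_ ?_
      · simp only [Set.ofPred_forall]
        exact isOpen_iInter_of_finite fun b => isOpen_lt continuous_const (continuous_apply b)
      · exact isOpen_lt (by fun_prop) continuous_const
    obtain ⟨q, h1, h2⟩ := hdense.exists_mem_open hopen ⟨fun _ => 1 / k, by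
      have h34 : 3 / (4 * k) < 1 / k := by
        rw [div_lt_div_iff₀ (by positivity) hk0]; linarith
      refine ⟨fun _ => h34, ?_⟩
      rw [Finset.sum_const, Finset.card_univ, nsmul_eq_mul, hcardk]
      have : (k - 1) * (1 / k) = 1 - 1 / k := by field_simp
      rw [this]
      linarith⟩
    exact ⟨q, h2, h1⟩
  let p : α → ℝ := fun a =>
    if a = c then 1 + ext q a else ext q a
  have hpc : p c = 1 - ∑ b, q b := by
    have : c ∉ F.erase c := by simp
    simp only [p, ext, this, dite_false, if_true]
    ring
  have hpb : ∀ b : ι, p b.1 = q b := by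
    intro b
    have : b.1 ≠ c := Finset.ne_of_mem_erase b.2
    simp only [p, ext, this, if_false, b.2, dite_true]
    rfl
  have h34pos : 0 < 3 / (4 * k) := by positivity
  have hpbig : ∀ a ∈ F, 3 / (4 * k) < p a := by
    intro a ha
    by_cases hac : a = c
    · rw [hac, hpc]; linarith [hqU.2]
    · have := hpb ⟨a, Finset.mem_erase.2 ⟨hac, ha⟩⟩
      rw [this]
      exact hqU.1 _
  refine ⟨g1, hg1, p, fun a ha => h34pos.trans (hpbig a ha), ?_, ?_, ?_⟩
  · intro a ha
    have h2 : a ≠ c := by rintro rfl; exact ha hc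
    simp only [p, h2, if_false, hext_out _ a ha]
  · have : ∀ a, p a = (if a = c then 1 else 0) + ext q a := by
      intro a
      by_cases hac : a = c <;> simp [p, hac]
    simp only [this, Finset.sum_add_distrib, hext_sum]
    simp
  · intro z hz
    rw [hv1] at hz
    have hz' : ∀ a, (g z).1 a + lam z * D z a = p a := by
      intro a
      rw [← hz]
      simp [W]
    have hm : 1 / (2 * k) ≤ h.m (g z) := by
      refine Finset.le_inf' _ _ fun a ha => ?_
      have h1 := hz' a
      have h2 := hpbig a ha
      have h6 := hDabs z a
      have h7 : |lam z * D z a| ≤ 1 / (4 * k) := by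
        rw [abs_mul, abs_of_nonneg (hlam0 z)]
        have h9 := abs_nonneg (D z a)
        nlinarith [hlam1 z, hlam0 z]
      have h8 := (abs_le.1 h7).2
      have h10 : 3 / (4 * k) - 1 / (4 * k) = 1 / (2 * k) := by field_simp; norm_num
      linarith
    apply hqw
    refine ⟨z, funext fun b => ?_⟩
    have h1 := hz' b.1
    rw [hlamo z hm, one_mul, hpb] at h1
    have h2 : D z b.1 = w z b - (g z).1 b.1 := by
      simp only [D, ext, b.2, dite_true]
      rfl
    rw [h2] at h1
    linarith

theorem Attach.nullS (h : Attach K K' F R) {i : ℕ} (hi : i + 2 ≤ F.card)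
    (hK : NullS i (SReal K)) : NullS i (SReal K') := by
  by_cases hne : R = F
  · subst hne
    intro g
    obtain ⟨g1, hg1, p, hp, hp0, hp1, hmiss⟩ := h.perturb hi g
    obtain ⟨g', hg'⟩ := h.push g1 p hp hp0 hp1 hmiss
    exact hK.of_factor h.inc g g' (hg1.trans hg')
  · exact h.collapse hne hK

end AttachPart

/-! ### Lexicographic shelling -/

section ShellPart
open scoped unitInterval Topology

theorem simplex_nullS {α : Type*} [Fintype α] {P : Finset α → Prop} {F : Finset α}
    (hF : F.Nonempty) (hP : ∀ G, P G ↔ G.Nonempty ∧ G ⊆ F) (i : ℕ) : NullS i (SReal P) := by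
  classical
  intro g
  obtain ⟨c, hc⟩ := hF
  have hPF : P F := (hP F).2 ⟨⟨c, hc⟩, Finset.Subset.refl _⟩
  have hout : ∀ f : SReal P, ∀ a, a ∉ F → f.1 a = 0 := by
    intro f a ha
    by_contra h0
    obtain ⟨G, hG, hs⟩ := f.2.2.2
    exact ha (((hP G).1 hG).2 (hs a h0))
  let x0 : SReal P := ⟨fun a => if a = c then 1 else 0, by
    intro a; dsimp only; split_ifs <;> norm_num, by simp, F, hPF, by
    intro a ha
    by_cases h : a = c
    · rw [h]; exact hc
    · simp [h] at ha⟩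
  refine ⟨x0, ⟨⟨⟨fun q => ⟨fun a => (1 - (q.1 : ℝ)) * (g q.2).1 a + (q.1 : ℝ) * x0.1 a,
    ?_, ?_, F, hPF, ?_⟩, ?_⟩, ?_, ?_⟩⟩⟩
  · intro a
    have h1 := (g q.2).2.1 a
    have h2 := x0.2.1 a
    have h3 := q.1.2.1
    have h4 := q.1.2.2
    have h5 : 0 ≤ 1 - (q.1 : ℝ) := by linarith
    positivity
  · rw [Finset.sum_add_distrib, ← Finset.mul_sum, ← Finset.mul_sum, (g q.2).2.2.1, x0.2.2.1]
    ring
  · intro a ha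
    by_contra hF
    exact ha (by have h1 := hout (g q.2) a hF; have h2 := hout x0 a hF; simp [h1, h2])
  · refine Continuous.subtype_mk (continuous_pi fun a => ?_) _
    have hgc : Continuous (fun p : I × FSph i => (g p.2).1 a) :=
      (continuous_apply a).comp (continuous_subtype_val.comp (g.continuous.comp continuous_snd))
    have ht : Continuous (fun p : I × FSph i => (p.1 : ℝ)) :=
      continuous_subtype_val.comp continuous_fst
    exact ((continuous_const.sub ht).mul hgc).add (ht.mul continuous_const)
  · intro z
    apply Subtype.ext
    funext a
    simp
  · intro z
    apply Subtype.ext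
    funext a
    simp

theorem augment_to {α : Type*} {J : Finset α → Prop}
    (aug : ∀ A B, J A → J B → A.card < B.card →
      ∃ C, J C ∧ A ⊆ C ∧ C.card = A.card + 1 ∧ ∀ x ∈ C, x ∈ A ∨ x ∈ B)
    {A B : Finset α} (hA : J A) (hB : J B) (hAB : A.card ≤ B.card) :
    ∃ C, J C ∧ A ⊆ C ∧ C.card = B.card ∧ ∀ x ∈ C, x ∈ A ∨ x ∈ B := by
  obtain ⟨n, hn⟩ : ∃ n, n = B.card - A.card := ⟨_, rfl⟩
  induction n generalizing A with
  | zero => exact ⟨A, hA, Finset.Subset.refl _, by omega, fun x hx => Or.inl hx⟩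
  | succ n ih =>
    obtain ⟨C, hC, hAC, hc, hx⟩ := aug A B hA hB (by omega)
    obtain ⟨D, hD, hCD, hd, hy⟩ := ih hC (by omega) (by omega)
    refine ⟨D, hD, hAC.trans hCD, hd, fun x hxD => ?_⟩
    rcases hy x hxD with h | h
    · exact hx x h
    · exact Or.inr h

theorem shell_nullS {α : Type*} [Fintype α] {J : Finset α → Prop}
    (mono : ∀ A B, J B → A ⊆ B → J A)
    (aug : ∀ A B, J A → J B → A.card < B.card →
      ∃ C, J C ∧ A ⊆ C ∧ C.card = A.card + 1 ∧ ∀ x ∈ C, x ∈ A ∨ x ∈ B)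
    {r : ℕ} (hex : ∀ A, J A → ∃ B, A ⊆ B ∧ J B ∧ B.card = r) (h0 : J ∅)
    {i : ℕ} (hi : i + 2 ≤ r) {P : Finset α → Prop} (hP : ∀ G, P G ↔ G.Nonempty ∧ J G) :
    NullS i (SReal P) := by
  classical
  let : LinearOrder α := LinearOrder.lift' (Fintype.equivFin α) (Fintype.equivFin α).injective
  -- the exchange property
  have exch : ∀ a B : Finset α, J a → a.card = r → J B → B.card = r → toColex a < toColex B →
      ∃ x ∈ a, x ∉ B ∧ ∃ C, J C ∧ C.card = r ∧ toColex a < toColex C ∧ a.erase x ⊆ C := by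
    intro a B ha har hB hBr hlt
    rw [Finset.Colex.toColex_lt_toColex_iff_exists_forall_lt] at hlt
    obtain ⟨b, hbB, hba, hmax⟩ := hlt
    have hsub : insert b (a ∩ B) ⊆ B := Finset.insert_subset hbB Finset.inter_subset_right
    obtain ⟨C, hC, hAC, hCr, hCx⟩ := augment_to aug (mono _ _ hB hsub) ha
      (by rw [har, ← hBr]; exact Finset.card_le_card hsub)
    have hbC : b ∈ C := hAC (Finset.mem_insert_self _ _)
    have hinter : ∀ y ∈ a, y ∈ B → y ∈ C := fun y hy hyB =>
      hAC (Finset.mem_insert_of_mem (Finset.mem_inter.2 ⟨hy, hyB⟩))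
    obtain ⟨x, hxa, hxC⟩ : ∃ x ∈ a, x ∉ C := by
      by_contra hcon
      push Not at hcon
      have := Finset.eq_of_subset_of_card_le hcon hCr.le
      exact hba (this ▸ hbC)
    have hCsub : C ⊆ insert b (a.erase x) := by
      intro y hy
      have hyx : y ≠ x := by rintro rfl; exact hxC hy
      rcases hCx y hy with h | h
      · rcases Finset.mem_insert.1 h with h | h
        · exact h ▸ Finset.mem_insert_self _ _
        · exact Finset.mem_insert_of_mem (Finset.mem_erase.2 ⟨hyx, (Finset.mem_inter.1 h).1⟩)
      · exact Finset.mem_insert_of_mem (Finset.mem_erase.2 ⟨hyx, h⟩)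
    have hCeq : C = insert b (a.erase x) := by
      refine Finset.eq_of_subset_of_card_le hCsub ?_
      rw [Finset.card_insert_of_notMem (fun h => hba (Finset.mem_of_mem_erase h)),
        Finset.card_erase_add_one hxa, hCr]
    refine ⟨x, hxa, fun hxB => hxC (hinter x hxa hxB), C, hC, hCr.trans har, ?_, ?_⟩
    · rw [Finset.Colex.toColex_lt_toColex_iff_exists_forall_lt]
      exact ⟨b, hbC, hba, fun y hy hyC => hmax y hy fun hyB => hyC (hinter y hy hyB)⟩
    · rw [hCeq]; exact Finset.subset_insert _ _
  -- induction along the shelling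
  have main : ∀ s : Finset (Colex (Finset α)),
      (∀ B ∈ s, J (ofColex B) ∧ (ofColex B).card = r) →
      (∀ B ∈ s, ∀ B' : Finset α, J B' → B'.card = r → B < toColex B' → toColex B' ∈ s) →
      s.Nonempty →
      NullS i (SReal (fun G : Finset α => G.Nonempty ∧ ∃ B ∈ s, G ⊆ ofColex B)) := by
    intro s
    induction s using Finset.induction_on_min with
    | empty => intro _ _ h; exact absurd h (by simp)
    | insert a s has ih =>
      intro hs hup _
      have haJ := hs a (Finset.mem_insert_self _ _)
      rcases s.eq_empty_or_nonempty with rfl | hne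
      · refine simplex_nullS (F := ofColex a) ?_ ?_ i
        · rw [← Finset.card_pos]; omega
        · intro G; simp
      have hsup : ∀ B ∈ s, ∀ B' : Finset α, J B' → B'.card = r → B < toColex B' →
          toColex B' ∈ s := by
        intro B hB B' h1 h2 h3
        rcases Finset.mem_insert.1 (hup B (Finset.mem_insert_of_mem hB) B' h1 h2 h3) with h | h
        · exact absurd ((has B hB).trans h3) (by rw [h]; exact lt_irrefl _)
        · exact h
      have hK := ih (fun B hB => hs B (Finset.mem_insert_of_mem hB)) hsup hne
      set R : Finset α := (ofColex a).filter (fun x => ∃ B ∈ s, (ofColex a).erase x ⊆ ofColex B)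
        with hR
      have hRex : ∀ B ∈ s, ∃ x ∈ R, x ∉ ofColex B := by
        intro B hB
        have hBJ := hs B (Finset.mem_insert_of_mem hB)
        obtain ⟨x, hxa, hxB, C, hC, hCr, hlt, hsubC⟩ :=
          exch (ofColex a) (ofColex B) haJ.1 haJ.2 hBJ.1 hBJ.2 (has B hB)
        refine ⟨x, Finset.mem_filter.2 ⟨hxa, toColex C, ?_, hsubC⟩, hxB⟩
        rcases Finset.mem_insert.1 (hup a (Finset.mem_insert_self _ _) C hC hCr hlt) with h | h
        · exact absurd hlt (by rw [h]; exact lt_irrefl _)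
        · exact h
      have hatt : Attach (fun G : Finset α => G.Nonempty ∧ ∃ B ∈ s, G ⊆ ofColex B)
          (fun G : Finset α => G.Nonempty ∧ ∃ B ∈ insert a s, G ⊆ ofColex B) (ofColex a) R := by
        refine ⟨?_, ?_, ?_, ?_, ?_, ?_, ?_⟩
        · rintro G ⟨h1, B, hB, h2⟩
          exact ⟨h1, B, Finset.mem_insert_of_mem hB, h2⟩
        · rintro G ⟨h1, B, hB, h2⟩
          rcases Finset.mem_insert.1 hB with h | h
          · right; rw [← h]; exact h2
          · left; exact ⟨h1, B, h, h2⟩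
        · rintro G ⟨h1, B, hB, h2⟩ hRG
          obtain ⟨x, hx, hxB⟩ := hRex B hB
          exact hxB (h2 (hRG hx))
        · refine ⟨?_, a, Finset.mem_insert_self _ _, Finset.Subset.refl _⟩
          rw [← Finset.card_pos]; omega
        · intro x hx
          obtain ⟨hxa, B, hB, h2⟩ := Finset.mem_filter.1 hx
          refine ⟨?_, B, hB, h2⟩
          rw [← Finset.card_pos, Finset.card_erase_of_mem hxa]; omega
        · exact Finset.filter_subset _ _
        · obtain ⟨B, hB⟩ := hne
          obtain ⟨x, hx, -⟩ := hRex B hB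
          exact ⟨x, hx⟩
      exact hatt.nullS (by omega) hK
  let s : Finset (Colex (Finset α)) :=
    (Finset.univ.filter (fun B : Finset α => J B ∧ B.card = r)).map toColex.toEmbedding
  have hms : ∀ B : Finset α, toColex B ∈ s ↔ J B ∧ B.card = r := by
    intro B; simp [s]
  have hfin := main s (fun B hB => (hms (ofColex B)).1 hB)
    (fun B _ B' h1 h2 _ => (hms B').2 ⟨h1, h2⟩) (by
      obtain ⟨B, -, h1, h2⟩ := hex ∅ h0
      exact ⟨toColex B, (hms B).2 ⟨h1, h2⟩⟩)
  have hPeq : P = fun G : Finset α => G.Nonempty ∧ ∃ B ∈ s, G ⊆ ofColex B := by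
    funext G
    apply propext
    rw [hP]
    refine and_congr_right fun _ => ⟨fun hG => ?_, ?_⟩
    · obtain ⟨B, hGB, h1, h2⟩ := hex G hG
      exact ⟨toColex B, (hms B).2 ⟨h1, h2⟩, hGB⟩
    · rintro ⟨B, hB, hG⟩
      exact mono _ _ ((hms (ofColex B)).1 hB).1 hG
  rw [hPeq]
  exact hfin

theorem isSpherical_of_matroid {α : Type*} [Fintype α] {J : Finset α → Prop}
    (mono : ∀ A B, J B → A ⊆ B → J A)
    (aug : ∀ A B, J A → J B → A.card < B.card →
      ∃ C, J C ∧ A ⊆ C ∧ C.card = A.card + 1 ∧ ∀ x ∈ C, x ∈ A ∨ x ∈ B)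
    {r : ℕ} (hle : ∀ A, J A → A.card ≤ r)
    (hex : ∀ A, J A → ∃ B, A ⊆ B ∧ J B ∧ B.card = r) (h0 : J ∅)
    {P : Finset α → Prop} (hP : ∀ G, P G ↔ G.Nonempty ∧ J G) {d : ℤ} (hd : d = r - 1) :
    IsSpherical d P := by
  classical
  subst hd
  obtain ⟨B, -, hB, hBr⟩ := hex ∅ h0
  refine ⟨?_, ?_, ?_, ?_⟩
  · intro S hS
    have := hle S ((hP S).1 hS).2
    omega
  · intro h
    refine ⟨B, (hP B).2 ⟨?_, hB⟩, by omega⟩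
    rw [← Finset.card_pos]; omega
  · intro h
    have hne : B.Nonempty := by rw [← Finset.card_pos]; omega
    have hPB := (hP B).2 ⟨hne, hB⟩
    obtain ⟨c, hc⟩ := hne
    refine ⟨⟨fun a => if a = c then 1 else 0, ?_, by simp, B, hPB, ?_⟩⟩
    · intro a; dsimp only; split_ifs <;> norm_num
    · intro a ha
      by_cases h : a = c
      · rw [h]; exact hc
      · simp [h] at ha
  · intro i hi x
    exact (shell_nullS mono aug hex h0 (by omega) hP).subsingleton x

end ShellPart

theorem link_isSpherical {V : Type*} [Fintype V] [DecidableEq V] (G : SimpleGraph V)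
    (S : Finset (Sym2 V)) (hS : FInd G S) {P : Finset (Sym2 V) → Prop}
    (hP : ∀ T, P T ↔ T.Nonempty ∧ Disjoint T S ∧ FInd G (T ∪ S)) :
    IsSpherical ((Fintype.card V : ℤ) - Nat.card G.ConnectedComponent - S.card - 1) P := by
  have hScard := hS.card_le
  have hcu : ∀ T : Finset (Sym2 V), Disjoint T S → (T ∪ S).card = T.card + S.card :=
    fun T hT => Finset.card_union_of_disjoint hT
  have hins : ∀ (T : Finset (Sym2 V)) (e : Sym2 V), Disjoint T S → e ∉ T ∪ S →
      FInd G (insert e (T ∪ S)) →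
      (Disjoint (insert e T) S ∧ FInd G (insert e T ∪ S)) ∧ (insert e T).card = T.card + 1 := by
    intro T e hT he hF
    rw [Finset.mem_union, not_or] at he
    refine ⟨⟨Finset.disjoint_insert_left.2 ⟨he.2, hT⟩, ?_⟩, Finset.card_insert_of_notMem he.1⟩
    rw [Finset.insert_union]
    exact hF
  refine isSpherical_of_matroid (J := fun T => Disjoint T S ∧ FInd G (T ∪ S))
    (r := Fintype.card V - Nat.card G.ConnectedComponent - S.card) ?_ ?_ ?_ ?_ ?_ hP ?_
  · rintro A B ⟨h1, h2⟩ hAB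
    exact ⟨Finset.disjoint_of_subset_left hAB h1,
      h2.mono (Finset.union_subset_union_left hAB)⟩
  · rintro A B ⟨hA, hA'⟩ ⟨hB, hB'⟩ hlt
    obtain ⟨e, he, heA, hF⟩ := hA'.augment hB' (by rw [hcu A hA, hcu B hB]; omega)
    obtain ⟨h1, h2⟩ := hins A e hA heA hF
    refine ⟨insert e A, h1, Finset.subset_insert _ _, h2, fun x hx => ?_⟩
    rcases Finset.mem_insert.1 hx with h | h
    · right
      rcases Finset.mem_union.1 he with h' | h'
      · rw [h]; exact h'
      · exact absurd (Finset.mem_union_right _ h') heA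
    · exact Or.inl h
  · rintro A ⟨hA, hA'⟩
    have := hA'.card_le
    rw [hcu A hA] at this
    omega
  · rintro A ⟨hA, hA'⟩
    obtain ⟨n, hn⟩ : ∃ n, n = Fintype.card V - Nat.card G.ConnectedComponent - S.card - A.card :=
      ⟨_, rfl⟩
    have hb := hA'.card_le
    rw [hcu A hA] at hb
    induction n generalizing A with
    | zero => exact ⟨A, Finset.Subset.refl _, ⟨hA, hA'⟩, by omega⟩
    | succ n ih =>
      obtain ⟨e, -, heA, hF⟩ := hA'.exists_insert (le_refl G) (by rw [hcu A hA]; omega)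
      obtain ⟨h1, h2⟩ := hins A e hA heA hF
      obtain ⟨B, hAB, hB⟩ := ih (insert e A) h1.1 h1.2 (by omega) (by omega)
      exact ⟨B, (Finset.subset_insert _ _).trans hAB, hB⟩
  · exact ⟨Finset.disjoint_empty_left _, by simpa using hS⟩
  · omega

/-- The forest complex of a finite graph `G` with `n` vertices and `c` components is
Cohen-Macaulay of dimension `n - c - 1`: it is `(n-c-1)`-spherical and the link of
every `d`-dimensional face is `(n - c - d - 2)`-spherical. -/
theorem forest_complex_cohen_macaulay {V : Type*} [Fintype V] [DecidableEq V]
    (G : SimpleGraph V) :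
    IsSpherical ((Fintype.card V : ℤ) - Nat.card G.ConnectedComponent - 1)
      (ForestFace G) ∧
    ∀ σ : Finset (Sym2 V), ForestFace G σ →
      IsSpherical ((Fintype.card V : ℤ) - Nat.card G.ConnectedComponent - σ.card - 1)
        (LinkFace (ForestFace G) σ) := by

  refine ⟨?_, fun S hS => ?_⟩
  · have h0 : FInd G ∅ := ⟨by simp, by simp⟩
    have := link_isSpherical G ∅ h0 (P := ForestFace G) (by
      intro T
      simp [ForestFace, FInd])
    simpa using this
  · refine link_isSpherical G S hS.2 ?_
    intro T
    simp only [LinkFace, ForestFace, FInd]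
    refine and_congr_right fun hT => and_congr_right fun _ => ?_
    exact and_iff_right (hT.mono Finset.subset_union_left)
end
end
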